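/- arXiv:2603.14746 — 2 statements merged into one kernel-verified Lean document; each statement's English description precedes it below -/
import Mathlib

section
/- Let S = (X, {(V_i, C_i)}_{i=1}^m) be a constraint system over a finite alphabet Σ, let π be a strictly positive probability distribution on [m], and let G(S,π) be the constraint-variable CS game. If c is a quantum correlation for G(S,π) with w_{G(S,π)}(c) ≥ 1 − ε, then there exists a finite-dimensional tracial correlation c′ for G(S,π) — i.e. n ≥ 1, PVMs of orthogonal projections {r^i_φ}_{φ∈C_i} (i ∈ [m]) and {r^x_σ}_{σ∈Σ} (x ∈ X) in M_n(ℂ), and a positive semidefinite σ₀ ∈ M_n(ℂ) with Tr(σ₀) = 1 and Tr(σ₀ u v) = Tr(σ₀ v u) for all u, v in the unital *-subalgebra generated by all these projections, with c′(φ,σ|i,x) = Tr(σ₀ r^i_φ r^x_σ) — such that w_{G(S,π)}(c′) ≥ 1 − 148(Lε)^{1/4}, where L = max_{i∈[m]} |V_i|. -/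
open scoped ComplexOrder Kronecker Matrix

namespace CSGame
open Matrix

variable {n m : Type*} [Fintype n] [DecidableEq n] [Fintype m]

lemma exists_unitary_diagonalization {H : Matrix n n ℂ} (hH : H.PosSemidef) :
    ∃ (U : Matrix n n ℂ) (a : n → ℝ), U * Uᴴ = 1 ∧ Uᴴ * U = 1 ∧ (∀ k, 0 ≤ a k) ∧
      Uᴴ * H * U = diagonal fun k => (a k : ℂ) := by
  refine ⟨hH.1.eigenvectorUnitary, hH.1.eigenvalues, ?_, ?_, hH.eigenvalues_nonneg, ?_⟩
  · exact Unitary.coe_mul_star_self _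
  · exact Unitary.coe_star_mul_self _
  · have := hH.1.conjStarAlgAut_star_eigenvectorUnitary
    rw [Unitary.conjStarAlgAut_apply] at this
    simpa [star_eq_conjTranspose, Function.comp_def] using this

lemma exists_factorization {A : Matrix n n ℂ} (hA : A.PosSemidef) :
    ∃ (C : Matrix n n ℂ) (a : n → ℝ), A = Cᴴ * C ∧ (∀ k, 0 ≤ a k) ∧
      C * Cᴴ = diagonal fun k => (a k : ℂ) := by
  obtain ⟨U, a, h1, h2, h3, h4⟩ := exists_unitary_diagonalization hA
  have hd : (diagonal fun k => ((√(a k) : ℝ) : ℂ)) * (diagonal fun k => ((√(a k) : ℝ) : ℂ)) =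
      diagonal fun k => (a k : ℂ) := by
    rw [diagonal_mul_diagonal]
    congr 1; ext k
    rw [← Complex.ofReal_mul, Real.mul_self_sqrt (h3 k)]
  have hs : (diagonal fun k => ((√(a k) : ℝ) : ℂ))ᴴ = diagonal fun k => ((√(a k) : ℝ) : ℂ) := by
    rw [diagonal_conjTranspose]; congr 1; ext k; simp
  refine ⟨(diagonal fun k => ((√(a k) : ℝ) : ℂ)) * Uᴴ, a, ?_, h3, ?_⟩
  · rw [conjTranspose_mul, conjTranspose_conjTranspose, hs]
    calc A = (U * Uᴴ) * A * (U * Uᴴ) := by simp [h1]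
      _ = U * (Uᴴ * A * U) * Uᴴ := by simp only [Matrix.mul_assoc]
      _ = _ := by rw [h4, ← hd]; simp only [Matrix.mul_assoc]
  · rw [conjTranspose_mul, conjTranspose_conjTranspose, hs, ← hd]
    calc _ = (diagonal fun k => ((√(a k) : ℝ) : ℂ)) * (Uᴴ * U) *
          (diagonal fun k => ((√(a k) : ℝ) : ℂ)) := by simp only [Matrix.mul_assoc]
      _ = _ := by rw [h2]; simp

lemma exists_unitary_trace_ge {T : Matrix n n ℂ} (hT : (1 - Tᴴ * T).PosSemidef) :
    ∃ W : Matrix n n ℂ, W * Wᴴ = 1 ∧ Wᴴ * W = 1 ∧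
      (Tᴴ * T).trace.re ≤ (Wᴴ * T).trace.re := by
  obtain ⟨U, a, h1, h2, h3, h4⟩ :=
    exists_unitary_diagonalization (posSemidef_conjTranspose_mul_self T)
  have ha1 : ∀ k, a k ≤ 1 := by
    intro k
    have h := (hT.conjTranspose_mul_mul_same U).diag_nonneg (i := k)
    rw [Matrix.mul_sub, Matrix.sub_mul, h4, Matrix.mul_one, h2] at h
    simp at h
    exact_mod_cast h
  set Y : Matrix n n ℂ := T * U with hY
  have hYY : Yᴴ * Y = diagonal fun k => (a k : ℂ) := by
    rw [← h4, hY, conjTranspose_mul]; simp only [Matrix.mul_assoc]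
  have hcol : ∀ k l, ∑ i, star (Y i k) * Y i l = if k = l then (a k : ℂ) else 0 := by
    intro k l
    have := congrFun (congrFun hYY k) l
    simpa [mul_apply, diagonal_apply] using this
  let v : n → EuclideanSpace ℂ n := fun k => WithLp.toLp 2 fun i => Y i k / (√(a k) : ℝ)
  have hinner : ∀ k l, inner ℂ (v k) (v l) =
      (if k = l then (a k : ℂ) else 0) / (((√(a k) : ℝ) : ℂ) * ((√(a l) : ℝ) : ℂ)) := by
    intro k l
    rw [← hcol, Finset.sum_div, PiLp.inner_apply]
    refine Finset.sum_congr rfl fun i _ => ?_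
    simp only [v, RCLike.inner_apply, map_div₀, Complex.conj_ofReal, RCLike.star_def]
    ring
  have hv : Orthonormal ℂ (Set.domRestrict {k | 0 < a k} v) := by
    rw [orthonormal_iff_ite]
    rintro ⟨k, hk⟩ ⟨l, hl⟩
    have hk' : (0:ℝ) < a k := hk
    simp only [Set.domRestrict_apply, hinner, Subtype.mk.injEq]
    split_ifs with h
    · subst h
      rw [← Complex.ofReal_mul, Real.mul_self_sqrt hk'.le, div_self]
      exact_mod_cast hk'.ne'
    · simp
  obtain ⟨b, hb⟩ := hv.exists_orthonormalBasis_extension_of_card_eq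
    (by simp : Module.finrank ℂ (EuclideanSpace ℂ n) = Fintype.card n)
  have hbo := orthonormal_iff_ite.1 b.orthonormal
  let W₀ : Matrix n n ℂ := Matrix.of fun i k => b k i
  have hW₀ : W₀ᴴ * W₀ = 1 := by
    ext k l
    have := hbo k l
    simp only [PiLp.inner_apply, RCLike.inner_apply] at this
    simp only [mul_apply, conjTranspose_apply, W₀, of_apply, one_apply, ← this, RCLike.star_def]
    exact Finset.sum_congr rfl fun i _ => mul_comm _ _
  have hW₀' : W₀ * W₀ᴴ = 1 := mul_eq_one_comm.1 hW₀
  refine ⟨W₀ * Uᴴ, ?_, ?_, ?_⟩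
  · rw [conjTranspose_mul, conjTranspose_conjTranspose]
    calc _ = W₀ * (Uᴴ * U) * W₀ᴴ := by simp only [Matrix.mul_assoc]
      _ = 1 := by rw [h2, Matrix.mul_one, hW₀']
  · rw [conjTranspose_mul, conjTranspose_conjTranspose]
    calc _ = U * (W₀ᴴ * W₀) * Uᴴ := by simp only [Matrix.mul_assoc]
      _ = 1 := by rw [hW₀, Matrix.mul_one, h1]
  · have e1 : (Tᴴ * T).trace = ∑ k, (a k : ℂ) := by
      calc (Tᴴ * T).trace = (Tᴴ * T * (U * Uᴴ)).trace := by rw [h1, Matrix.mul_one]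
        _ = (Uᴴ * (Tᴴ * T) * U).trace := by
          rw [← Matrix.mul_assoc, trace_mul_comm]; simp only [Matrix.mul_assoc]
        _ = _ := by rw [h4, trace_diagonal]
    have e2 : ((W₀ * Uᴴ)ᴴ * T).trace = (W₀ᴴ * Y).trace := by
      rw [conjTranspose_mul, conjTranspose_conjTranspose, Matrix.mul_assoc, trace_mul_comm, hY,
        Matrix.mul_assoc]
    have e3 : (W₀ᴴ * Y).trace = ∑ k, ((√(a k) : ℝ) : ℂ) := by
      simp only [trace, diag_apply, mul_apply, conjTranspose_apply]
      refine Finset.sum_congr rfl fun k _ => ?_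
      rcases (h3 k).eq_or_lt with h0 | h0
      · have hz : ∀ i, Y i k = 0 := by
          have h := hcol k k
          rw [if_pos rfl, ← h0] at h
          have h' : ∑ i, ‖Y i k‖ ^ 2 = 0 := by
            have := congrArg Complex.re h
            simpa [Complex.conj_mul', ← Complex.ofReal_pow] using this
          intro i
          have := (Finset.sum_eq_zero_iff_of_nonneg (fun i _ => by positivity)).1 h' i
            (Finset.mem_univ _)
          simpa using this
        simp [hz, ← h0]
      · have hbk : ∀ i, b k i = Y i k / (√(a k) : ℝ) := fun i => by rw [hb k h0]
        have h := hcol k k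
        rw [if_pos rfl] at h
        have hs : ((√(a k) : ℝ) : ℂ) ≠ 0 := by
          exact_mod_cast (Real.sqrt_pos.2 h0).ne'
        have hs2 : (a k : ℂ) = ((√(a k) : ℝ) : ℂ) * ((√(a k) : ℝ) : ℂ) := by
          rw [← Complex.ofReal_mul, Real.mul_self_sqrt h0.le]
        simp only [W₀, of_apply, hbk, star_div₀, RCLike.star_def, Complex.conj_ofReal]
        simp only [div_mul_eq_mul_div, ← Finset.sum_div]
        rw [div_eq_iff hs, ← hs2, ← h]; simp
    rw [e1, e2, e3]
    simp only [← Complex.ofReal_sum, Complex.ofReal_re]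
    refine Finset.sum_le_sum fun k _ => ?_
    exact Real.le_sqrt_of_sq_le (by nlinarith [h3 k, ha1 k])

section Pairing

variable {ι Φ Sig : Type*} [Fintype ι] [Fintype Φ] [Fintype Sig]

/-- The real part of `Tr (D M D Nᴴ)`, where `D` is the diagonal matrix with entries `s`. -/
def pairing (s : ι → ℝ) (M N : Matrix ι ι ℂ) : ℝ :=
  ∑ k, ∑ l, s k * s l * (M k l * star (N k l)).re

/-- A finite family of positive semidefinite matrices summing to the identity. -/
structure IsPOVM [DecidableEq ι] (A : Φ → Matrix ι ι ℂ) : Prop where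
  posSemidef : ∀ φ, (A φ).PosSemidef
  sum_eq_one : ∑ φ, A φ = 1

/-- The coarse-graining of a family of matrices along a map of outcomes. -/
def marginal [DecidableEq Sig] (A : Φ → Matrix ι ι ℂ) (g : Φ → Sig) (σ : Sig) : Matrix ι ι ℂ :=
  ∑ φ, if g φ = σ then A φ else 0

variable (s : ι → ℝ)

lemma pairing_comm (M N : Matrix ι ι ℂ) : pairing s M N = pairing s N M := by
  unfold pairing
  refine Finset.sum_congr rfl fun k _ => Finset.sum_congr rfl fun l _ => ?_
  simp only [Complex.mul_re, RCLike.star_def, Complex.conj_re, Complex.conj_im]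
  ring

lemma pairing_sum_left {κ : Type*} (t : Finset κ) (M : κ → Matrix ι ι ℂ) (N : Matrix ι ι ℂ) :
    pairing s (∑ a ∈ t, M a) N = ∑ a ∈ t, pairing s (M a) N := by
  unfold pairing
  simp only [Matrix.sum_apply, Finset.sum_mul, Complex.re_sum, Finset.mul_sum]
  exact (Finset.sum_congr rfl fun k _ => Finset.sum_comm).trans Finset.sum_comm

lemma pairing_sum_right {κ : Type*} (t : Finset κ) (M : Matrix ι ι ℂ) (N : κ → Matrix ι ι ℂ) :
    pairing s M (∑ a ∈ t, N a) = ∑ a ∈ t, pairing s M (N a) := by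
  rw [pairing_comm, pairing_sum_left]
  exact Finset.sum_congr rfl fun _ _ => pairing_comm s _ _

lemma pairing_self (M : Matrix ι ι ℂ) :
    pairing s M M = ∑ k, ∑ l, s k * s l * ‖M k l‖ ^ 2 := by
  unfold pairing
  refine Finset.sum_congr rfl fun k _ => Finset.sum_congr rfl fun l _ => ?_
  rw [RCLike.star_def, Complex.mul_conj']
  norm_cast

lemma pairing_sub_self (M N : Matrix ι ι ℂ) :
    pairing s (M - N) (M - N) = pairing s M M + pairing s N N - 2 * pairing s M N := by
  unfold pairing
  simp only [Finset.mul_sum, ← Finset.sum_add_distrib, ← Finset.sum_sub_distrib]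
  refine Finset.sum_congr rfl fun k _ => Finset.sum_congr rfl fun l _ => ?_
  simp only [Complex.mul_re, RCLike.star_def, Complex.conj_re, Complex.conj_im,
    Matrix.sub_apply, Complex.sub_re, Complex.sub_im]
  ring

lemma pairing_zero_left (N : Matrix ι ι ℂ) : pairing s 0 N = 0 := by
  simp [pairing]

lemma pairing_zero_right (N : Matrix ι ι ℂ) : pairing s N 0 = 0 := by
  simp [pairing]

variable [DecidableEq ι]

lemma pairing_one_one : pairing s 1 1 = ∑ k, s k ^ 2 := by
  unfold pairing
  refine Finset.sum_congr rfl fun k _ => ?_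
  rw [Finset.sum_eq_single k]
  · simp; ring
  · intro l _ h; simp [Ne.symm h]
  · simp

lemma pairing_nonneg {M N : Matrix ι ι ℂ} (hM : M.PosSemidef) (hN : N.PosSemidef) :
    0 ≤ pairing s M N := by
  obtain ⟨C, -, rfl, -, -⟩ := exists_factorization hN
  have h : ∀ j, 0 ≤ (star (fun l => (s l : ℂ) * star (C j l)) ⬝ᵥ
      (M *ᵥ fun l => (s l : ℂ) * star (C j l))).re := fun j =>
    (Complex.le_def.1 (hM.dotProduct_mulVec_nonneg _)).1
  have e : pairing s M (Cᴴ * C) = ∑ j, (star (fun l => (s l : ℂ) * star (C j l)) ⬝ᵥ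
      (M *ᵥ fun l => (s l : ℂ) * star (C j l))).re := by
    rw [← Complex.re_sum]
    unfold pairing
    simp only [← Complex.re_ofReal_mul, ← Complex.re_sum]
    congr 1
    simp only [dotProduct, mulVec, mul_apply, conjTranspose_apply, Finset.mul_sum, star_sum,
      Pi.star_apply, star_mul', star_star]
    symm
    rw [Finset.sum_comm]
    refine Finset.sum_congr rfl fun k _ => ?_
    rw [Finset.sum_comm]
    refine Finset.sum_congr rfl fun l _ => Finset.sum_congr rfl fun j _ => ?_
    simp only [RCLike.star_def, Complex.conj_ofReal]
    push_cast
    ring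
  rw [e]
  exact Finset.sum_nonneg fun j _ => h j

variable {s}

namespace IsPOVM

variable {A B : Φ → Matrix ι ι ℂ}

omit [Fintype ι] in
lemma marginal [DecidableEq Sig] (hA : IsPOVM A) (g : Φ → Sig) :
    IsPOVM (marginal A g) where
  posSemidef σ := by
    refine posSemidef_sum _ fun φ _ => ?_
    split_ifs
    · exact hA.posSemidef φ
    · exact PosSemidef.zero
  sum_eq_one := by
    unfold CSGame.marginal
    rw [Finset.sum_comm, ← hA.sum_eq_one]
    simp

lemma sum_sum_pairing (hA : IsPOVM A) (s : ι → ℝ) :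
    ∑ φ, ∑ φ', pairing s (A φ) (A φ') = ∑ k, s k ^ 2 := by
  simp only [← pairing_sum_right, ← pairing_sum_left, hA.sum_eq_one, pairing_one_one]

lemma sum_pairing_self_le (hA : IsPOVM A) (s : ι → ℝ) :
    ∑ φ, pairing s (A φ) (A φ) ≤ ∑ k, s k ^ 2 := by
  rw [← hA.sum_sum_pairing s]
  refine Finset.sum_le_sum fun φ _ => ?_
  exact Finset.single_le_sum (f := fun φ' => pairing s (A φ) (A φ'))
    (fun φ' _ => pairing_nonneg s (hA.posSemidef φ) (hA.posSemidef φ')) (Finset.mem_univ φ)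

omit [DecidableEq ι] in
lemma sum_marginal_pairing [DecidableEq Sig] (s : ι → ℝ) (A B : Φ → Matrix ι ι ℂ) (g : Φ → Sig) :
    ∑ σ, pairing s (CSGame.marginal A g σ) (CSGame.marginal B g σ) =
      ∑ φ, ∑ φ', if g φ = g φ' then pairing s (A φ) (B φ') else 0 := by
  simp only [CSGame.marginal, pairing_sum_left]
  rw [Finset.sum_comm]
  refine Finset.sum_congr rfl fun φ _ => ?_
  simp only [pairing_sum_right]
  rw [Finset.sum_comm]
  refine Finset.sum_congr rfl fun φ' _ => ?_
  rw [Finset.sum_eq_single (g φ)]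
  · rw [if_pos rfl]
    by_cases h : g φ = g φ'
    · rw [if_pos h.symm, if_pos h]
    · rw [if_neg (Ne.symm h), if_neg h, pairing_zero_right]
  · intro σ _ h
    rw [if_neg (Ne.symm h), pairing_zero_left]
  · simp

lemma sum_pairing_le_sum_marginal [DecidableEq Sig] (hA : IsPOVM A) (hB : IsPOVM B)
    (s : ι → ℝ) (g : Φ → Sig) :
    ∑ φ, pairing s (A φ) (B φ) ≤
      ∑ σ, pairing s (CSGame.marginal A g σ) (CSGame.marginal B g σ) := by
  rw [sum_marginal_pairing]
  refine Finset.sum_le_sum fun φ _ => ?_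
  have := Finset.single_le_sum
    (f := fun φ' => if g φ = g φ' then pairing s (A φ) (B φ') else 0)
    (fun φ' _ => by
      split_ifs
      · exact pairing_nonneg s (hA.posSemidef φ) (hB.posSemidef φ')
      · exact le_rfl) (Finset.mem_univ φ)
  simpa using this

lemma union_bound [DecidableEq Sig] {V : Type*} [Fintype V] (hA : IsPOVM A) (s : ι → ℝ)
    (g : V → Φ → Sig) (hg : ∀ φ φ', (∀ x, g x φ = g x φ') → φ = φ') :
    ∑ k, s k ^ 2 - ∑ φ, pairing s (A φ) (A φ) ≤
      ∑ x, (∑ k, s k ^ 2 -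
        ∑ σ, pairing s (CSGame.marginal A (g x) σ) (CSGame.marginal A (g x) σ)) := by
  classical
  simp only [sum_marginal_pairing]
  rw [← hA.sum_sum_pairing s]
  simp only [← Finset.sum_sub_distrib]
  rw [Finset.sum_comm]
  refine Finset.sum_le_sum fun φ _ => ?_
  rw [Finset.sum_comm]
  have h1 : pairing s (A φ) (A φ) = ∑ φ', if φ = φ' then pairing s (A φ) (A φ') else 0 := by
    simp
  rw [h1, ← Finset.sum_sub_distrib]
  refine Finset.sum_le_sum fun φ' _ => ?_
  have hp := pairing_nonneg s (hA.posSemidef φ) (hA.posSemidef φ')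
  have hterm : ∀ x, 0 ≤ pairing s (A φ) (A φ') -
      if g x φ = g x φ' then pairing s (A φ) (A φ') else 0 := by
    intro x; split_ifs <;> simp [hp]
  by_cases h : φ = φ'
  · rw [if_pos h, sub_self]
    exact Finset.sum_nonneg fun x _ => hterm x
  · rw [if_neg h]
    obtain ⟨x, hx⟩ : ∃ x, g x φ ≠ g x φ' := by
      by_contra! hcon
      exact h (hg _ _ hcon)
    refine le_trans ?_ (Finset.single_le_sum (fun x _ => hterm x) (Finset.mem_univ x))
    rw [if_neg hx]

lemma sum_norm_sq_le (hA : IsPOVM A) (φ : Φ) (k : ι) :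
    ∑ l, ‖A φ k l‖ ^ 2 ≤ (A φ k k).re := by
  classical
  have h1 : (1 - A φ).PosSemidef := by
    have : 1 - A φ = ∑ φ' ∈ Finset.univ.erase φ, A φ' := by
      rw [← hA.sum_eq_one, ← Finset.add_sum_erase _ _ (Finset.mem_univ φ)]
      simp
    rw [this]
    exact posSemidef_sum _ fun φ' _ => hA.posSemidef φ'
  have h0 := hA.posSemidef φ
  have h2 := (h1.conjTranspose_mul_mul_same (A φ)).add (h0.conjTranspose_mul_mul_same (1 - A φ))
  have e : (A φ)ᴴ * (1 - A φ) * A φ + (1 - A φ)ᴴ * A φ * (1 - A φ) = A φ - A φ * (A φ)ᴴ := by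
    rw [h1.1.eq, h0.1.eq]
    noncomm_ring
  rw [e] at h2
  have h3 := (Complex.le_def.1 (h2.diag_nonneg (i := k))).1
  simp only [Matrix.sub_apply, mul_apply, conjTranspose_apply, RCLike.star_def, Complex.mul_conj',
    Complex.sub_re, Complex.re_sum, Complex.zero_re, ← Complex.ofReal_pow, Complex.ofReal_re] at h3
  linarith

lemma sum_weighted_norm_sq_le (hA : IsPOVM A) (s : ι → ℝ) :
    ∑ φ, ∑ k, ∑ l, s k ^ 2 * ‖A φ k l‖ ^ 2 ≤ ∑ k, s k ^ 2 := by
  have h : ∀ k, ∑ φ, (A φ k k).re = 1 := by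
    intro k
    rw [← Complex.re_sum, ← Matrix.sum_apply, hA.sum_eq_one]
    simp
  calc ∑ φ, ∑ k, ∑ l, s k ^ 2 * ‖A φ k l‖ ^ 2 ≤ ∑ φ, ∑ k, s k ^ 2 * (A φ k k).re := by
        refine Finset.sum_le_sum fun φ _ => Finset.sum_le_sum fun k _ => ?_
        rw [← Finset.mul_sum]
        exact mul_le_mul_of_nonneg_left (hA.sum_norm_sq_le φ k) (sq_nonneg _)
    _ = ∑ k, s k ^ 2 := by
        rw [Finset.sum_comm]
        refine Finset.sum_congr rfl fun k _ => ?_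
        rw [← Finset.mul_sum, h, mul_one]

/-- If a POVM nearly commutes with the diagonal weights `s`, then it is nearly projective with
respect to the weights `min (s k ^ 2) (s l ^ 2)`. -/
lemma le_sum_min_norm_sq (hA : IsPOVM A) (hs : ∀ k, 0 < s k) (hs1 : ∑ k, s k ^ 2 = 1)
    {Δ θ : ℝ} (hθ : 0 < θ) (h : 1 - 2 * Δ ≤ ∑ φ, pairing s (A φ) (A φ)) :
    1 - ∑ φ, ∑ k, ∑ l, min (s k ^ 2) (s l ^ 2) * ‖A φ k l‖ ^ 2 ≤
      2 * Δ + θ / 2 + 2 * Δ / θ := by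
  have ha := hA.sum_pairing_self_le s
  have hb := hA.sum_weighted_norm_sq_le s
  rw [hs1] at ha hb
  have hb' : ∑ φ, ∑ k, ∑ l, s l ^ 2 * ‖A φ k l‖ ^ 2 = ∑ φ, ∑ k, ∑ l, s k ^ 2 * ‖A φ k l‖ ^ 2 := by
    refine Finset.sum_congr rfl fun φ _ => ?_
    rw [Finset.sum_comm]
    refine Finset.sum_congr rfl fun k _ => Finset.sum_congr rfl fun l _ => ?_
    rw [← (hA.posSemidef φ).1.apply, norm_star]
  have hmin : ∀ k l, s k * s l * (1 - θ / 2) - (s k - s l) ^ 2 / (2 * θ) ≤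
      min (s k ^ 2) (s l ^ 2) := by
    have key : ∀ a b : ℝ, 0 < a → a ≤ b →
        a * b * (1 - θ / 2) - (b - a) ^ 2 / (2 * θ) ≤ a ^ 2 := by
      intro a b h1 h2
      have : a * (b - a) ≤ θ / 2 * (a * b) + (b - a) ^ 2 / (2 * θ) := by
        have h3 : 0 ≤ (θ * a - (b - a)) ^ 2 / (2 * θ) := by positivity
        have h4 : (θ * a - (b - a)) ^ 2 / (2 * θ) =
            θ / 2 * a ^ 2 - a * (b - a) + (b - a) ^ 2 / (2 * θ) := by
          field_simp; ring
        nlinarith [mul_nonneg hθ.le (mul_nonneg h1.le (sub_nonneg.2 h2))]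
      nlinarith
    intro k l
    rcases le_total (s k) (s l) with h | h
    · rw [min_eq_left (by nlinarith [hs k])]
      have := key _ _ (hs k) h
      rw [show (s k - s l) ^ 2 = (s l - s k) ^ 2 by ring]
      exact this
    · rw [min_eq_right (by nlinarith [hs l])]
      have := key _ _ (hs l) h
      rw [mul_comm (s k)]
      exact this
  have hsum : ∑ φ, ∑ k, ∑ l, (s k * s l * (1 - θ / 2) - (s k - s l) ^ 2 / (2 * θ)) *
      ‖A φ k l‖ ^ 2 ≤ ∑ φ, ∑ k, ∑ l, min (s k ^ 2) (s l ^ 2) * ‖A φ k l‖ ^ 2 :=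
    Finset.sum_le_sum fun φ _ => Finset.sum_le_sum fun k _ => Finset.sum_le_sum fun l _ =>
      mul_le_mul_of_nonneg_right (hmin k l) (by positivity)
  have hexp : ∑ φ, ∑ k, ∑ l, (s k * s l * (1 - θ / 2) - (s k - s l) ^ 2 / (2 * θ)) *
      ‖A φ k l‖ ^ 2 = (1 - θ / 2 + 1 / θ) * ∑ φ, pairing s (A φ) (A φ)
        - 1 / (2 * θ) * ∑ φ, ∑ k, ∑ l, s k ^ 2 * ‖A φ k l‖ ^ 2
        - 1 / (2 * θ) * ∑ φ, ∑ k, ∑ l, s l ^ 2 * ‖A φ k l‖ ^ 2 := by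
    simp only [pairing_self, Finset.mul_sum, ← Finset.sum_sub_distrib]
    refine Finset.sum_congr rfl fun φ _ => Finset.sum_congr rfl fun k _ =>
      Finset.sum_congr rfl fun l _ => ?_
    field_simp
    ring
  rw [hexp, hb'] at hsum
  set a := ∑ φ, pairing s (A φ) (A φ)
  set b := ∑ φ, ∑ k, ∑ l, s k ^ 2 * ‖A φ k l‖ ^ 2
  have h5 : 1 / θ * (b - a) ≤ 1 / θ * (2 * Δ) :=
    mul_le_mul_of_nonneg_left (by linarith) (by positivity)
  have h6 : (1 - θ / 2 + 1 / θ) * a - 1 / (2 * θ) * b - 1 / (2 * θ) * b =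
      a - θ / 2 * a - 1 / θ * (b - a) := by field_simp; ring
  have h7 : 1 / θ * (2 * Δ) = 2 * Δ / θ := by ring
  nlinarith

end IsPOVM

end Pairing
section Selection

lemma exists_nonempty_sum_nonpos {ι : Type*} (s : Finset ι) (hs : s.Nonempty) (μ : ι → ℝ)
    (hμ : ∀ k ∈ s, 0 < μ k) (G : ι → ι → ℝ)
    (h : ∑ k ∈ s, ∑ l ∈ s, min (μ k) (μ l) * G k l ≤ 0) :
    ∃ S : Finset ι, S.Nonempty ∧ ∑ k ∈ S, ∑ l ∈ S, G k l ≤ 0 := by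
  classical
  induction s using Finset.strongInduction generalizing μ with
  | H s ih =>
    by_contra! hcon
    obtain ⟨k₀, hk₀, hmin⟩ := s.exists_min_image μ hs
    have hsum : ∑ k ∈ s, ∑ l ∈ s, min (μ k) (μ l) * G k l =
        μ k₀ * ∑ k ∈ s, ∑ l ∈ s, G k l + ∑ k ∈ s with μ k₀ < μ k, ∑ l ∈ s with μ k₀ < μ l,
          min (μ k - μ k₀) (μ l - μ k₀) * G k l := by
      rw [Finset.sum_filter, Finset.mul_sum, ← Finset.sum_add_distrib]
      refine Finset.sum_congr rfl fun k hk => ?_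
      rw [Finset.sum_filter, Finset.mul_sum]
      by_cases h1 : μ k₀ < μ k
      · rw [if_pos h1, ← Finset.sum_add_distrib]
        refine Finset.sum_congr rfl fun l hl => ?_
        by_cases h2 : μ k₀ < μ l
        · rw [if_pos h2, min_sub_sub_right]; ring
        · rw [if_neg h2, add_zero, ← le_antisymm (hmin l hl) (not_lt.1 h2), min_eq_right h1.le]
      · rw [if_neg h1, add_zero]
        refine Finset.sum_congr rfl fun l hl => ?_
        rw [← le_antisymm (hmin k hk) (not_lt.1 h1), min_eq_left (hmin l hl)]
    have hpos := mul_pos (hμ k₀ hk₀) (hcon s hs)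
    rcases (s.filter fun k => μ k₀ < μ k).eq_empty_or_nonempty with he | hne
    · rw [hsum, he] at h
      simp at h
      linarith
    · refine absurd (ih (s.filter fun k => μ k₀ < μ k) ?_ hne (fun k => μ k - μ k₀) ?_ ?_) ?_
      · exact Finset.filter_ssubset.2 ⟨k₀, hk₀, lt_irrefl _⟩
      · intro k hk
        exact sub_pos.2 (Finset.mem_filter.1 hk).2
      · rw [hsum] at h
        linarith
      · push Not
        exact hcon

lemma exists_top_subset {κ : Type*} [Fintype κ] (a : κ → ℝ) (n : ℕ) (hn : n ≤ Fintype.card κ) :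
    ∃ J : Finset κ, J.card = n ∧ ∀ i ∈ J, ∀ j ∉ J, a j ≤ a i := by
  classical
  induction n with
  | zero => exact ⟨∅, rfl, by simp⟩
  | succ n ih =>
    obtain ⟨J, hJ, hJa⟩ := ih (by omega)
    have hne : (Jᶜ).Nonempty := by
      rw [← Finset.card_pos, Finset.card_compl]; omega
    obtain ⟨p, hp, hmax⟩ := Finset.exists_max_image _ a hne
    rw [Finset.mem_compl] at hp
    refine ⟨insert p J, by rw [Finset.card_insert_of_notMem hp, hJ], ?_⟩
    intro i hi j hj
    rw [Finset.mem_insert, not_or] at hj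
    rcases Finset.mem_insert.1 hi with rfl | hi
    · exact hmax j (Finset.mem_compl.2 hj.2)
    · exact hJa i hi j hj.2

lemma exists_subset_sum_ge {κ : Type*} [Fintype κ] (a : κ → ℝ) (n : ℕ) (hn : n ≤ Fintype.card κ)
    (ha : ∀ i, a i ^ 2 ≤ a i) (hsum : ∑ i, a i = n) :
    ∃ J : Finset κ, J.card = n ∧ ∑ i, a i ^ 2 ≤ ∑ i ∈ J, a i := by
  classical
  obtain ⟨J, hJ, hJa⟩ := exists_top_subset a n hn
  refine ⟨J, hJ, ?_⟩
  have h0 : ∀ i, 0 ≤ a i := fun i => (sq_nonneg _).trans (ha i)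
  have h1 : ∀ i, a i ≤ 1 := fun i => by nlinarith [ha i, h0 i]
  rcases J.eq_empty_or_nonempty with rfl | hne
  · have hz : ∑ i, a i = 0 := by rw [hsum, ← hJ]; simp
    simp only [Finset.sum_empty]
    rw [← hz]
    exact Finset.sum_le_sum fun i _ => ha i
  · obtain ⟨i₀, hi₀, hmin⟩ := J.exists_min_image a hne
    have e1 := Finset.sum_add_sum_compl J a
    have e2 := Finset.sum_add_sum_compl J fun i => a i ^ 2
    have h2 : ∑ i ∈ Jᶜ, a i ^ 2 ≤ a i₀ * ∑ i ∈ Jᶜ, a i := by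
      rw [Finset.mul_sum]
      refine Finset.sum_le_sum fun i hi => ?_
      have := hJa i₀ hi₀ i (Finset.mem_compl.1 hi)
      nlinarith [h0 i]
    have h3 : a i₀ * ∑ i ∈ J, (1 - a i) ≤ ∑ i ∈ J, (a i - a i ^ 2) := by
      rw [Finset.mul_sum]
      refine Finset.sum_le_sum fun i hi => ?_
      nlinarith [hmin i hi, h1 i]
    rw [Finset.sum_sub_distrib, Finset.sum_sub_distrib, Finset.sum_const, hJ, nsmul_eq_mul,
      mul_one] at h3
    have e3 : ∑ i ∈ Jᶜ, a i = n - ∑ i ∈ J, a i := by linarith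
    rw [e3] at h2
    linarith

end Selection

section Rounding

variable {n : ℕ} {Φ : Type*} [Fintype Φ]

lemma pairing_one_eq_trace {ι : Type*} [Fintype ι] (M N : Matrix ι ι ℂ) :
    pairing (fun _ => 1) M N = (M * Nᴴ).trace.re := by
  simp [pairing, trace, mul_apply, Complex.re_sum]

/-- A POVM which is nearly projective in the tracial sense is close to a PVM. -/
lemma IsPOVM.exists_projective [Nonempty Φ] {A : Φ → Matrix (Fin n) (Fin n) ℂ} (hA : IsPOVM A) :
    ∃ R : Φ → Matrix (Fin n) (Fin n) ℂ, IsPOVM R ∧ (∀ φ, R φ * R φ = R φ) ∧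
      2 * ∑ φ, pairing (fun _ => 1) (A φ) (A φ) - n ≤
        ∑ φ, pairing (fun _ => 1) (R φ) (A φ) := by
  classical
  choose C a hAC ha0 hCC using fun φ => exists_factorization (hA.posSemidef φ)
  have hle : ∀ p : Φ × Fin n, a p.1 p.2 ^ 2 ≤ a p.1 p.2 := by
    rintro ⟨φ, j⟩
    have h1 : (1 - A φ).PosSemidef := by
      have : 1 - A φ = ∑ φ' ∈ Finset.univ.erase φ, A φ' := by
        rw [← hA.sum_eq_one, ← Finset.add_sum_erase _ _ (Finset.mem_univ φ)]
        simp
      rw [this]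
      exact posSemidef_sum _ fun φ' _ => hA.posSemidef φ'
    have h2 := (h1.mul_mul_conjTranspose_same (C φ)).diag_nonneg (i := j)
    have e : C φ * (1 - A φ) * (C φ)ᴴ = C φ * (C φ)ᴴ - (C φ * (C φ)ᴴ) * (C φ * (C φ)ᴴ) := by
      rw [hAC]; noncomm_ring
    rw [e, hCC, diagonal_mul_diagonal] at h2
    simp only [Matrix.sub_apply, diagonal_apply_eq] at h2
    norm_cast at h2
    nlinarith
  have hsum : ∑ p : Φ × Fin n, a p.1 p.2 = n := by
    have h : ∑ φ, (A φ).trace = n := by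
      rw [← trace_sum, hA.sum_eq_one]; simp
    have h' : ∀ φ, (A φ).trace = ((∑ j, a φ j : ℝ) : ℂ) := by
      intro φ
      rw [hAC, trace_mul_comm, hCC, trace_diagonal]; push_cast; rfl
    simp only [h'] at h
    rw [Fintype.sum_prod_type]
    exact_mod_cast h
  have hsq : ∑ φ, pairing (fun _ => 1) (A φ) (A φ) = ∑ p : Φ × Fin n, a p.1 p.2 ^ 2 := by
    rw [Fintype.sum_prod_type]
    refine Finset.sum_congr rfl fun φ _ => ?_
    rw [pairing_one_eq_trace, (hA.posSemidef φ).1.eq]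
    have : (A φ * A φ).trace = ((C φ * (C φ)ᴴ) * (C φ * (C φ)ᴴ)).trace := by
      rw [hAC, Matrix.mul_assoc, trace_mul_comm]; simp only [Matrix.mul_assoc]
    rw [this, hCC, diagonal_mul_diagonal, trace_diagonal, Complex.re_sum]
    refine Finset.sum_congr rfl fun j _ => ?_
    norm_cast; ring
  obtain ⟨J, hJ, hJsum⟩ := exists_subset_sum_ge (fun p : Φ × Fin n => a p.1 p.2) n (by
    rw [Fintype.card_prod, Fintype.card_fin]
    exact Nat.le_mul_of_pos_left _ Fintype.card_pos) hle hsum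
  have e : Fin n ≃ J := (Fintype.equivFinOfCardEq (by simpa using hJ)).symm
  let T : Matrix (Fin n) (Fin n) ℂ := of fun m l => C (e m).1.1 (e m).1.2 l
  have hTT : Tᴴ * T = ∑ p ∈ J, vecMulVec (star (C p.1 p.2)) (C p.1 p.2) := by
    ext k l
    rw [mul_apply, Matrix.sum_apply, ← Finset.sum_coe_sort J, ← e.sum_comp]
    rfl
  have hall : ∑ p : Φ × Fin n, vecMulVec (star (C p.1 p.2)) (C p.1 p.2) = 1 := by
    rw [← hA.sum_eq_one, Fintype.sum_prod_type]
    refine Finset.sum_congr rfl fun φ _ => ?_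
    rw [hAC]
    ext k l
    rw [mul_apply, Matrix.sum_apply]
    rfl
  have hT : (1 - Tᴴ * T).PosSemidef := by
    rw [hTT, ← hall, ← Finset.sum_add_sum_compl J, add_sub_cancel_left]
    exact posSemidef_sum _ fun p _ => posSemidef_vecMulVec_star_self _
  obtain ⟨W, hW1, hW2, hW⟩ := exists_unitary_trace_ge hT
  have hTr : (Tᴴ * T).trace.re = ∑ p ∈ J, a p.1 p.2 := by
    rw [trace_mul_comm, trace, Complex.re_sum, ← Finset.sum_coe_sort J, ← e.sum_comp]
    refine Finset.sum_congr rfl fun m _ => ?_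
    have := congrFun (congrFun (hCC (e m).1.1) (e m).1.2) (e m).1.2
    rw [diagonal_apply_eq, mul_apply] at this
    rw [diag_apply, mul_apply]
    exact (congrArg Complex.re this).trans (Complex.ofReal_re _)
  let D : Φ → Matrix (Fin n) (Fin n) ℂ := fun φ => diagonal fun m => if (e m).1.1 = φ then 1 else 0
  have hDD : ∀ φ, D φ * D φ = D φ := by
    intro φ
    simp only [D, diagonal_mul_diagonal]
    congr 1; ext m; split_ifs <;> simp
  have hDs : ∑ φ, D φ = 1 := by
    ext k l
    simp only [D, Matrix.sum_apply, diagonal_apply, one_apply]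
    by_cases h : k = l <;> simp [h]
  refine ⟨fun φ => Wᴴ * D φ * W, ⟨?_, ?_⟩, ?_, ?_⟩
  · intro φ
    refine PosSemidef.conjTranspose_mul_mul_same ?_ W
    refine posSemidef_diagonal_iff.2 fun m => ?_
    split_ifs <;> simp
  · rw [← Matrix.sum_mul, ← Matrix.mul_sum, hDs, Matrix.mul_one, hW2]
  · intro φ
    calc _ = Wᴴ * D φ * (W * Wᴴ) * D φ * W := by simp only [Matrix.mul_assoc]
      _ = _ := by rw [hW1, Matrix.mul_one, Matrix.mul_assoc Wᴴ, hDD]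
  · have hpair : ∀ φ, pairing (fun _ => 1) (Wᴴ * D φ * W) (A φ) =
        ∑ m, if (e m).1.1 = φ then ∑ j, ‖(C φ * Wᴴ) j m‖ ^ 2 else 0 := by
      intro φ
      rw [pairing_one_eq_trace, (hA.posSemidef φ).1.eq]
      have h1 : (Wᴴ * D φ * W * A φ).trace = (D φ * ((C φ * Wᴴ)ᴴ * (C φ * Wᴴ))).trace := by
        rw [Matrix.mul_assoc, Matrix.mul_assoc, trace_mul_comm, hAC, conjTranspose_mul,
          conjTranspose_conjTranspose]
        simp only [Matrix.mul_assoc]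
      rw [h1, trace, Complex.re_sum]
      refine Finset.sum_congr rfl fun m _ => ?_
      simp only [D, diag_apply, diagonal_mul]
      split_ifs with h
      · rw [one_mul, mul_apply, Complex.re_sum]
        refine Finset.sum_congr rfl fun j _ => ?_
        rw [conjTranspose_apply, RCLike.star_def, Complex.conj_mul']
        norm_cast
      · simp
    simp only [hpair]
    rw [Finset.sum_comm]
    simp only [Finset.sum_ite_eq, Finset.mem_univ, if_true]
    have hrow : ∀ m, (C (e m).1.1 * Wᴴ) (e m).1.2 m = (T * Wᴴ) m m := by
      intro m; rw [mul_apply, mul_apply]; rfl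
    have hWT : (Wᴴ * T).trace.re = ∑ m, ((T * Wᴴ) m m).re := by
      rw [trace_mul_comm, trace, Complex.re_sum]; rfl
    have hterm : ∀ m, 2 * ((T * Wᴴ) m m).re - 1 ≤
        ∑ j, ‖(C (e m).1.1 * Wᴴ) j m‖ ^ 2 := by
      intro m
      refine le_trans ?_ (Finset.single_le_sum
        (f := fun j => ‖(C (e m).1.1 * Wᴴ) j m‖ ^ 2) (fun j _ => by positivity)
        (Finset.mem_univ (e m).1.2))
      simp only [hrow]
      nlinarith [Complex.re_le_norm ((T * Wᴴ) m m), sq_nonneg (‖(T * Wᴴ) m m‖ - 1)]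
    refine le_trans ?_ (Finset.sum_le_sum fun m _ => hterm m)
    rw [Finset.sum_sub_distrib, ← Finset.mul_sum, ← hWT, hsq]
    simp only [Finset.sum_const, Finset.card_univ, Fintype.card_fin, nsmul_eq_mul, mul_one]
    linarith

end Rounding

lemma exists_schmidt {m n : Type} [Fintype m] [Fintype n] [DecidableEq n] (ψ : m × n → ℂ) :
    ∃ (ι : Type) (_ : Fintype ι) (_ : DecidableEq ι) (U : Matrix m ι ℂ) (V : Matrix n ι ℂ)
      (s : ι → ℝ), Uᴴ * U = 1 ∧ Vᴴ * V = 1 ∧ (∀ k, 0 < s k) ∧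
      ∀ p, ψ p = ∑ k, s k * (U p.1 k * V p.2 k) := by
  classical
  let K : Matrix m n ℂ := of fun i j => ψ (i, j)
  obtain ⟨W, a, h1, h2, h3, h4⟩ :=
    exists_unitary_diagonalization (posSemidef_conjTranspose_mul_self K)
  set Y : Matrix m n ℂ := K * W with hY
  have hYY : Yᴴ * Y = diagonal fun k => (a k : ℂ) := by
    rw [← h4, hY, conjTranspose_mul]; simp only [Matrix.mul_assoc]
  have hcol : ∀ k l, ∑ i, star (Y i k) * Y i l = if k = l then (a k : ℂ) else 0 := by
    intro k l
    have := congrFun (congrFun hYY k) l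
    simpa [mul_apply, diagonal_apply] using this
  have hzero : ∀ k, ¬ 0 < a k → ∀ i, Y i k = 0 := by
    intro k hk
    have h0 : a k = 0 := le_antisymm (not_lt.1 hk) (h3 k)
    have h := hcol k k
    rw [if_pos rfl, h0] at h
    have h' : ∑ i, ‖Y i k‖ ^ 2 = 0 := by
      have := congrArg Complex.re h
      simpa [Complex.conj_mul', ← Complex.ofReal_pow] using this
    intro i
    have := (Finset.sum_eq_zero_iff_of_nonneg (fun i _ => by positivity)).1 h' i
      (Finset.mem_univ _)
    simpa using this
  refine ⟨{k // 0 < a k}, inferInstance, inferInstance, of fun i k => Y i k / (√(a k) : ℝ),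
    of fun j k => star (W j k), fun k => √(a k), ?_, ?_, fun k => Real.sqrt_pos.2 k.2, ?_⟩
  · ext k l
    simp only [mul_apply, conjTranspose_apply, of_apply, star_div₀, RCLike.star_def,
      Complex.conj_ofReal]
    have : ∀ i, (starRingEnd ℂ) (Y i k) / ((√(a k) : ℝ) : ℂ) * (Y i l / ((√(a l) : ℝ) : ℂ)) =
        (star (Y i k) * Y i l) / (((√(a k) : ℝ) : ℂ) * ((√(a l) : ℝ) : ℂ)) := by
      intro i
      rw [RCLike.star_def]; ring
    simp only [this, ← Finset.sum_div, hcol, one_apply, Subtype.ext_iff]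
    split_ifs with h
    · rw [← h, ← Complex.ofReal_mul, Real.mul_self_sqrt k.2.le, div_self]
      exact_mod_cast k.2.ne'
    · simp
  · ext k l
    have := congrFun (congrFun h2 l) k
    simp only [mul_apply, conjTranspose_apply, one_apply] at this
    simp only [mul_apply, conjTranspose_apply, of_apply, star_star, one_apply]
    rw [Finset.sum_congr rfl fun j _ => mul_comm _ _, this]
    simp [Subtype.ext_iff, eq_comm]
  · rintro ⟨i, j⟩
    have hK : K = Y * Wᴴ := by rw [hY, Matrix.mul_assoc, h1, Matrix.mul_one]
    have : ψ (i, j) = ∑ k, Y i k * star (W j k) := by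
      have := congrFun (congrFun hK i) j
      simpa [mul_apply, K] using this
    have hsub : ∑ k, Y i k * star (W j k) = ∑ k : {k // 0 < a k}, Y i k * star (W j k) := by
      rw [← Finset.sum_filter_of_ne (p := fun k => 0 < a k) fun k _ hk => by
        by_contra h
        exact hk (by rw [hzero k h i, zero_mul])]
      exact Finset.sum_subtype _ (by simp) _
    rw [this, hsub]
    refine Finset.sum_congr rfl fun k _ => ?_
    have hs : ((√(a k) : ℝ) : ℂ) ≠ 0 := by
      exact_mod_cast (Real.sqrt_pos.2 k.2).ne'
    simp only [of_apply]
    field_simp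
section Corner

variable {ι Sig : Type*} [Fintype ι] [DecidableEq ι] [Fintype Sig] [DecidableEq Sig]

omit [Fintype ι] in
lemma IsPOVM.submatrix {κ Φ : Type*} [DecidableEq κ] [Fintype Φ] {A : Φ → Matrix ι ι ℂ}
    (hA : IsPOVM A) {e : κ → ι} (he : Function.Injective e) :
    IsPOVM fun φ => (A φ).submatrix e e where
  posSemidef φ := (hA.posSemidef φ).submatrix e
  sum_eq_one := by
    ext k l
    have := congrFun (congrFun hA.sum_eq_one (e k)) (e l)
    simpa [Matrix.sum_apply, one_apply, he.eq_iff] using this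

lemma IsPOVM.compression {κ Φ : Type*} [Fintype κ] [DecidableEq κ] [Fintype Φ]
    {P : Φ → Matrix κ κ ℂ} (hP : IsPOVM P) {U : Matrix κ ι ℂ} (hU : Uᴴ * U = 1) :
    IsPOVM fun φ => Uᴴ * P φ * U where
  posSemidef φ := (hP.posSemidef φ).conjTranspose_mul_mul_same U
  sum_eq_one := by
    rw [← Matrix.sum_mul, ← Matrix.mul_sum, hP.sum_eq_one, Matrix.mul_one, hU]

omit [Fintype ι] in
lemma IsPOVM.transpose {Φ : Type*} [Fintype Φ] {P : Φ → Matrix ι ι ℂ} (hP : IsPOVM P) :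
    IsPOVM fun φ => (P φ)ᵀ where
  posSemidef φ := (hP.posSemidef φ).transpose
  sum_eq_one := by rw [← transpose_sum, hP.sum_eq_one, transpose_one]

omit [Fintype Sig] [DecidableEq ι] in
lemma sum_pairing_marginal {Φ : Type*} [Fintype Φ] [Fintype Sig] (s : ι → ℝ)
    (A : Φ → Matrix ι ι ℂ) (g : Φ → Sig) (B : Sig → Matrix ι ι ℂ) :
    ∑ σ, pairing s (marginal A g σ) (B σ) = ∑ φ, pairing s (A φ) (B (g φ)) := by
  simp only [marginal, pairing_sum_left]
  rw [Finset.sum_comm]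
  refine Finset.sum_congr rfl fun φ _ => ?_
  rw [Finset.sum_eq_single (g φ)]
  · rw [if_pos rfl]
  · intro σ _ h
    rw [if_neg (Ne.symm h), pairing_zero_left]
  · simp

omit [Fintype ι] [DecidableEq ι] in
lemma sum_mul_sum_comm {J : Type*} [Fintype J] (S : Finset ι) (W : ι → ι → ℝ) (w : J → ℝ)
    (h : J → ι → ι → ℝ) :
    ∑ k ∈ S, ∑ l ∈ S, W k l * ∑ j, w j * h j k l =
      ∑ j, w j * ∑ k ∈ S, ∑ l ∈ S, W k l * h j k l := by
  simp only [Finset.mul_sum]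
  rw [(Finset.sum_congr rfl fun k _ => Finset.sum_comm).trans Finset.sum_comm]
  refine Finset.sum_congr rfl fun j _ => Finset.sum_congr rfl fun k _ =>
    Finset.sum_congr rfl fun l _ => ?_
  ring

omit [Fintype ι] [DecidableEq ι] in
lemma sum_sum_mul_sum {κ : Type*} [Fintype κ] (S : Finset ι) (W : ι → ι → ℝ)
    (M : κ → Matrix ι ι ℂ) :
    ∑ φ, ∑ k ∈ S, ∑ l ∈ S, W k l * ‖M φ k l‖ ^ 2 =
      ∑ k ∈ S, ∑ l ∈ S, W k l * ∑ φ, ‖M φ k l‖ ^ 2 := by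
  simp only [Finset.mul_sum]
  exact ((Finset.sum_congr rfl fun k _ => Finset.sum_comm).trans Finset.sum_comm).symm

omit [Fintype ι] [DecidableEq Sig] in
lemma sum_weighted_defect {Φ : Type*} [Fintype Φ] (S : Finset ι) (W : ι → ι → ℝ)
    (A : Φ → Matrix ι ι ℂ) (B D : Sig → Matrix ι ι ℂ) (c : ℝ) :
    ∑ k ∈ S, ∑ l ∈ S, W k l * ((12 - c) * (if k = l then 1 else 0) -
        6 * (∑ φ, ‖A φ k l‖ ^ 2) - 6 * (∑ σ, ‖B σ k l‖ ^ 2) + 3 / 2 * ∑ σ, ‖D σ k l‖ ^ 2) =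
      (12 - c) * (∑ k ∈ S, W k k) - 6 * (∑ φ, ∑ k ∈ S, ∑ l ∈ S, W k l * ‖A φ k l‖ ^ 2) -
        6 * (∑ σ, ∑ k ∈ S, ∑ l ∈ S, W k l * ‖B σ k l‖ ^ 2) +
        3 / 2 * ∑ σ, ∑ k ∈ S, ∑ l ∈ S, W k l * ‖D σ k l‖ ^ 2 := by
  have h : ∑ k ∈ S, W k k = ∑ k ∈ S, ∑ l ∈ S, W k l * (if k = l then 1 else 0) := by
    refine Finset.sum_congr rfl fun k hk => ?_
    simp [hk]
  rw [sum_sum_mul_sum, sum_sum_mul_sum, sum_sum_mul_sum, h]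
  have key : ∀ d a b e : ι → ι → ℝ, ∑ k ∈ S, ∑ l ∈ S,
      W k l * ((12 - c) * d k l - 6 * a k l - 6 * b k l + 3 / 2 * e k l) =
      (12 - c) * (∑ k ∈ S, ∑ l ∈ S, W k l * d k l) - 6 * (∑ k ∈ S, ∑ l ∈ S, W k l * a k l) -
        6 * (∑ k ∈ S, ∑ l ∈ S, W k l * b k l) +
        3 / 2 * ∑ k ∈ S, ∑ l ∈ S, W k l * e k l := by
    intro d a b e
    simp only [Finset.mul_sum, ← Finset.sum_sub_distrib, ← Finset.sum_add_distrib]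
    refine Finset.sum_congr rfl fun k _ => Finset.sum_congr rfl fun l _ => ?_
    ring
  exact key (fun k l => if k = l then 1 else 0) (fun k l => ∑ φ, ‖A φ k l‖ ^ 2)
    (fun k l => ∑ σ, ‖B σ k l‖ ^ 2) fun k l => ∑ σ, ‖D σ k l‖ ^ 2

omit [Fintype ι] [DecidableEq ι] in
lemma pairing_one_submatrix {n : ℕ} {S : Finset ι} (e : Fin n ≃ S) (M : Matrix ι ι ℂ) :
    pairing (fun _ => 1) (M.submatrix (fun k => (e k : ι)) fun k => (e k : ι))
      (M.submatrix (fun k => (e k : ι)) fun k => (e k : ι)) =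
      ∑ k ∈ S, ∑ l ∈ S, 1 * ‖M k l‖ ^ 2 := by
  rw [pairing_self, ← Finset.sum_coe_sort S, ← e.sum_comp]
  refine Finset.sum_congr rfl fun k _ => ?_
  rw [← Finset.sum_coe_sort S, ← e.sum_comp]
  simp

omit [DecidableEq Sig] in
lemma IsPOVM.sum_pairing_sub_le {A B : Sig → Matrix ι ι ℂ} (hA : IsPOVM A) (hB : IsPOVM B)
    (s : ι → ℝ) :
    ∑ σ, pairing s (A σ - B σ) (A σ - B σ) ≤
      2 * (∑ k, s k ^ 2 - ∑ σ, pairing s (A σ) (B σ)) := by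
  have h1 := hA.sum_pairing_self_le s
  have h2 := hB.sum_pairing_self_le s
  simp only [pairing_sub_self, Finset.sum_sub_distrib, Finset.sum_add_distrib, ← Finset.mul_sum]
  linarith

/-- Families of POVMs that are nearly consistent in the state with Schmidt coefficients `s` can be
cut down to a corner on which, on average, they are nearly projective and nearly consistent with
respect to the trace. -/
lemma exists_corner {J : Type*} [Fintype J] {Φ : J → Type*} [∀ j, Fintype (Φ j)]
    {A : ∀ j, Φ j → Matrix ι ι ℂ} {B : J → Sig → Matrix ι ι ℂ} (g : ∀ j, Φ j → Sig)
    (hA : ∀ j, IsPOVM (A j)) (hB : ∀ j, IsPOVM (B j))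
    {s : ι → ℝ} (hs : ∀ k, 0 < s k) (hs1 : ∑ k, s k ^ 2 = 1)
    {w : J → ℝ} (hw : ∀ j, 0 ≤ w j) (hw1 : ∑ j, w j = 1) {Δ δ : J → ℝ} {T : ℝ} (hT : 0 ≤ T)
    (hΔ : ∀ j, 1 - 2 * Δ j ≤ ∑ φ, pairing s (A j φ) (A j φ))
    (hδ : ∀ j, 1 - δ j ≤ ∑ σ, pairing s (marginal (A j) (g j) σ) (B j σ))
    (hΔT : ∑ j, w j * Δ j ≤ T) (hδT : ∑ j, w j * δ j ≤ T) :
    ∃ (n : ℕ) (e : Fin n → ι), 1 ≤ n ∧ Function.Injective e ∧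
      ∑ j, w j * (6 * (n - ∑ φ, pairing (fun _ => 1) ((A j φ).submatrix e e)
            ((A j φ).submatrix e e)) +
          6 * (n - ∑ σ, pairing (fun _ => 1) ((B j σ).submatrix e e) ((B j σ).submatrix e e)) +
          3 / 2 * ∑ σ, pairing (fun _ => 1)
            ((marginal (A j) (g j) σ - B j σ).submatrix e e)
            ((marginal (A j) (g j) σ - B j σ).submatrix e e)) ≤
        n * (27 * T + 30 * √T) := by
  have hne : (Finset.univ : Finset ι).Nonempty := by
    rw [Finset.nonempty_iff_ne_empty]
    intro h
    rw [h] at hs1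
    simp at hs1
  set c := 27 * T + 30 * √T with hc
  let D : ∀ j, Sig → Matrix ι ι ℂ := fun j σ => marginal (A j) (g j) σ - B j σ
  let h : J → ι → ι → ℝ := fun j k l => (12 - c) * (if k = l then 1 else 0) -
        6 * (∑ φ, ‖A j φ k l‖ ^ 2) - 6 * (∑ σ, ‖B j σ k l‖ ^ 2) + 3 / 2 * ∑ σ, ‖D j σ k l‖ ^ 2
  have hD : ∀ j, ∑ σ, ∑ k, ∑ l, min (s k ^ 2) (s l ^ 2) * ‖D j σ k l‖ ^ 2 ≤ 2 * δ j := by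
    intro j
    have h1 := ((hA j).marginal (g j)).sum_pairing_sub_le (hB j) s
    rw [hs1] at h1
    have h2 : ∑ σ, ∑ k, ∑ l, min (s k ^ 2) (s l ^ 2) * ‖D j σ k l‖ ^ 2 ≤
        ∑ σ, pairing s (D j σ) (D j σ) := by
      refine Finset.sum_le_sum fun σ _ => ?_
      rw [pairing_self]
      refine Finset.sum_le_sum fun k _ => Finset.sum_le_sum fun l _ => ?_
      refine mul_le_mul_of_nonneg_right ?_ (by positivity)
      rcases le_total (s k) (s l) with h | h
      · exact (min_le_left _ _).trans (by nlinarith [hs k])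
      · exact (min_le_right _ _).trans (by nlinarith [hs l])
    have h3 := hδ j
    linarith
  have hBB : ∀ j, 1 - 2 * δ j ≤ ∑ σ, pairing s (B j σ) (B j σ) := by
    intro j
    have h1 := ((hA j).marginal (g j)).sum_pairing_self_le s
    rw [hs1] at h1
    have h2 : 0 ≤ ∑ σ, pairing s (D j σ) (D j σ) := by
      refine Finset.sum_nonneg fun σ _ => ?_
      rw [pairing_self]
      refine Finset.sum_nonneg fun k _ => Finset.sum_nonneg fun l _ => ?_
      have := hs k
      have := hs l
      positivity
    simp only [D, pairing_sub_self, Finset.sum_sub_distrib, Finset.sum_add_distrib,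
      ← Finset.mul_sum] at h2
    have h3 := hδ j
    linarith
  have hθ : ∀ θ : ℝ, 0 < θ → ∑ j, w j * ∑ k, ∑ l, min (s k ^ 2) (s l ^ 2) * h j k l ≤
      27 * T + 6 * θ + 24 * T / θ - c := by
    intro θ hθ
    have hj : ∀ j, ∑ k, ∑ l, min (s k ^ 2) (s l ^ 2) * h j k l ≤
        (12 + 12 / θ) * Δ j + (15 + 12 / θ) * δ j + (6 * θ - c) := by
      intro j
      have h1 := (hA j).le_sum_min_norm_sq hs hs1 hθ (hΔ j)
      have h2 := (hB j).le_sum_min_norm_sq hs hs1 hθ (hBB j)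
      have h3 := hD j
      simp only [h, sum_weighted_defect, min_self, hs1]
      have e1 : 12 / θ * Δ j = 6 * (2 * Δ j / θ) := by ring
      have e2 : 12 / θ * δ j = 6 * (2 * δ j / θ) := by ring
      rw [add_mul, add_mul, e1, e2]
      linarith
    calc ∑ j, w j * ∑ k, ∑ l, min (s k ^ 2) (s l ^ 2) * h j k l
        ≤ ∑ j, w j * ((12 + 12 / θ) * Δ j + (15 + 12 / θ) * δ j + (6 * θ - c)) :=
          Finset.sum_le_sum fun j _ => mul_le_mul_of_nonneg_left (hj j) (hw j)
      _ = (12 + 12 / θ) * (∑ j, w j * Δ j) + (15 + 12 / θ) * (∑ j, w j * δ j) +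
          (6 * θ - c) * ∑ j, w j := by
          simp only [Finset.mul_sum, ← Finset.sum_add_distrib]
          refine Finset.sum_congr rfl fun j _ => ?_
          ring
      _ ≤ (12 + 12 / θ) * T + (15 + 12 / θ) * T + (6 * θ - c) * 1 := by
          rw [hw1]
          have : 0 < 12 / θ := by positivity
          gcongr
      _ = _ := by ring
  have hle : ∑ j, w j * ∑ k, ∑ l, min (s k ^ 2) (s l ^ 2) * h j k l ≤ 0 := by
    rcases hT.eq_or_lt with h0 | h0
    · refine le_of_forall_pos_le_add fun η hη => ?_
      have := hθ (η / 6) (by positivity)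
      rw [hc, ← h0] at this
      simp only [mul_zero, Real.sqrt_zero, zero_div] at this
      linarith
    · have hq : 0 < √T := Real.sqrt_pos.2 h0
      have := hθ (√T) hq
      have e : 24 * T / √T = 24 * √T := by
        rw [mul_div_assoc, Real.div_sqrt]
      rw [e] at this
      linarith
  rw [← sum_mul_sum_comm] at hle
  obtain ⟨S, hS, hSle⟩ := exists_nonempty_sum_nonpos Finset.univ hne (fun k => s k ^ 2)
    (fun k _ => pow_pos (hs k) 2) _ hle
  have e : Fin S.card ≃ S := (Fintype.equivFinOfCardEq (by simp)).symm
  refine ⟨S.card, fun k => e k, Finset.card_pos.2 hS,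
    Subtype.val_injective.comp e.injective, ?_⟩
  have h1 := sum_mul_sum_comm S (fun _ _ => 1) w h
  simp only [one_mul] at h1
  rw [h1] at hSle
  have h2 : ∀ j, ∑ k ∈ S, ∑ l ∈ S, h j k l = _ := fun j =>
    (by simp only [one_mul] : ∑ k ∈ S, ∑ l ∈ S, h j k l = ∑ k ∈ S, ∑ l ∈ S, 1 * h j k l).trans
      (sum_weighted_defect S (fun _ _ => 1) (A j) (B j) (D j) c)
  simp only [h2, ← pairing_one_submatrix e, Finset.sum_const, nsmul_eq_mul, mul_one] at hSle
  have h3 : (S.card : ℝ) * c = ∑ j, w j * (S.card * c) := by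
    rw [← Finset.sum_mul, hw1, one_mul]
  rw [h3, ← sub_nonpos, ← Finset.sum_sub_distrib]
  refine le_trans (le_of_eq ?_) hSle
  refine Finset.sum_congr rfl fun j _ => ?_
  simp only [D]
  ring

omit [DecidableEq ι] in
lemma pairing_one_sub_le (M N P Q : Matrix ι ι ℂ) :
    pairing (fun _ => 1) (M - Q) (M - Q) ≤ 3 * (pairing (fun _ => 1) (M - N) (M - N) +
      pairing (fun _ => 1) (N - P) (N - P) + pairing (fun _ => 1) (P - Q) (P - Q)) := by
  simp only [pairing_self, ← Finset.sum_add_distrib, Finset.mul_sum]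
  refine Finset.sum_le_sum fun k _ => Finset.sum_le_sum fun l _ => ?_
  simp only [Matrix.sub_apply, one_mul]
  have h : ‖M k l - Q k l‖ ≤ ‖M k l - N k l‖ + ‖N k l - P k l‖ + ‖P k l - Q k l‖ := by
    have : M k l - Q k l = (M k l - N k l) + (N k l - P k l) + (P k l - Q k l) := by ring
    rw [this]
    exact norm_add₃_le
  nlinarith [norm_nonneg (M k l - Q k l), sq_nonneg (‖M k l - N k l‖ - ‖N k l - P k l‖),
    sq_nonneg (‖M k l - N k l‖ - ‖P k l - Q k l‖), sq_nonneg (‖N k l - P k l‖ - ‖P k l - Q k l‖)]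

lemma IsPOVM.sum_pairing_self_of_idempotent {Φ : Type*} [Fintype Φ] {R : Φ → Matrix ι ι ℂ}
    (hR : IsPOVM R) (hRR : ∀ φ, R φ * R φ = R φ) :
    ∑ φ, pairing (fun _ => 1) (R φ) (R φ) = Fintype.card ι := by
  simp only [pairing_one_eq_trace, (hR.posSemidef _).1.eq, hRR]
  rw [← Complex.re_sum, ← trace_sum, hR.sum_eq_one]
  simp

lemma card_sub_sum_pairing_le {Φ : Type*} [Fintype Φ] {A R : Φ → Matrix ι ι ℂ}
    {B S : Sig → Matrix ι ι ℂ} (g : Φ → Sig) (hA : IsPOVM A) (hB : IsPOVM B)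
    (hR : IsPOVM R) (hRR : ∀ φ, R φ * R φ = R φ) (hS : IsPOVM S) (hSS : ∀ σ, S σ * S σ = S σ)
    (hRA : 2 * ∑ φ, pairing (fun _ => 1) (A φ) (A φ) - Fintype.card ι ≤
      ∑ φ, pairing (fun _ => 1) (R φ) (A φ))
    (hSB : 2 * ∑ σ, pairing (fun _ => 1) (B σ) (B σ) - Fintype.card ι ≤
      ∑ σ, pairing (fun _ => 1) (S σ) (B σ)) :
    Fintype.card ι - ∑ φ, pairing (fun _ => 1) (R φ) (S (g φ)) ≤
      6 * (Fintype.card ι - ∑ φ, pairing (fun _ => 1) (A φ) (A φ)) +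
      6 * (Fintype.card ι - ∑ σ, pairing (fun _ => 1) (B σ) (B σ)) +
      3 / 2 * ∑ σ, pairing (fun _ => 1) (marginal A g σ - B σ) (marginal A g σ - B σ) := by
  have h1 : ∑ σ, pairing (fun _ => 1) (marginal R g σ - S σ) (marginal R g σ - S σ) ≤
      ∑ σ, 3 * (pairing (fun _ => 1) (marginal R g σ - marginal A g σ)
          (marginal R g σ - marginal A g σ) +
        pairing (fun _ => 1) (marginal A g σ - B σ) (marginal A g σ - B σ) +
        pairing (fun _ => 1) (B σ - S σ) (B σ - S σ)) :=
    Finset.sum_le_sum fun σ _ => pairing_one_sub_le _ _ _ _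
  rw [← Finset.mul_sum, Finset.sum_add_distrib, Finset.sum_add_distrib] at h1
  have h2 := (hR.marginal g).sum_pairing_sub_le (hA.marginal g) fun _ => 1
  have h3 := hB.sum_pairing_sub_le hS fun _ => 1
  have h4 := hR.sum_pairing_le_sum_marginal hA (fun _ => 1) g
  have h5 := hR.sum_pairing_le_sum_marginal hR (fun _ => 1) g
  rw [hR.sum_pairing_self_of_idempotent hRR] at h5
  have h6 := hS.sum_pairing_self_of_idempotent hSS
  have h7 : ∑ σ, pairing (fun _ => 1) (B σ) (S σ) = ∑ σ, pairing (fun _ => 1) (S σ) (B σ) :=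
    Finset.sum_congr rfl fun σ _ => pairing_comm _ _ _
  rw [← sum_pairing_marginal]
  simp only [one_pow, Finset.sum_const, Finset.card_univ, nsmul_eq_mul, mul_one] at h2 h3
  have h8 : ∑ σ, pairing (fun _ => 1) (marginal R g σ - S σ) (marginal R g σ - S σ) =
      ∑ σ, pairing (fun _ => 1) (marginal R g σ) (marginal R g σ) +
        ∑ σ, pairing (fun _ => 1) (S σ) (S σ) -
        2 * ∑ σ, pairing (fun _ => 1) (marginal R g σ) (S σ) := by
    simp only [pairing_sub_self, Finset.sum_sub_distrib, Finset.sum_add_distrib,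
      ← Finset.mul_sum]
  linarith

end Corner

lemma correlation_eq_sum {ι : Type} {m n : Type*} [Fintype ι] [Fintype m] [Fintype n]
    {ψ : m × n → ℂ} {U : Matrix m ι ℂ} {V : Matrix n ι ℂ} {s : ι → ℝ}
    (hψ : ∀ p, ψ p = ∑ k, s k * (U p.1 k * V p.2 k)) (P : Matrix m m ℂ) (Q : Matrix n n ℂ) :
    star ψ ⬝ᵥ ((P ⊗ₖ Q) *ᵥ ψ) =
      ∑ k, ∑ l, (s k * s l : ℂ) * ((Uᴴ * P * U) k l * (Vᴴ * Q * V) k l) := by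
  have hv : ψ = fun p => ∑ k, s k * (U p.1 k * V p.2 k) := funext hψ
  have h1 : ∀ p, ((P ⊗ₖ Q) *ᵥ ψ) p = ∑ l, s l * ((P * U) p.1 l * (Q * V) p.2 l) := by
    intro p
    simp only [mulVec, dotProduct, hψ, kroneckerMap_apply, Finset.mul_sum, mul_apply,
      Finset.sum_mul, Fintype.sum_prod_type]
    rw [(Finset.sum_congr rfl fun k _ => Finset.sum_comm).trans Finset.sum_comm]
    refine Finset.sum_congr rfl fun l _ => ?_
    rw [Finset.sum_comm]
    refine Finset.sum_congr rfl fun a _ => Finset.sum_congr rfl fun b _ => ?_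
    ring
  simp only [dotProduct, h1, Pi.star_apply, hψ, star_sum, Matrix.mul_assoc]
  simp only [Finset.sum_mul_sum]
  rw [Finset.sum_comm]
  refine Finset.sum_congr rfl fun k _ => ?_
  rw [Finset.sum_comm]
  refine Finset.sum_congr rfl fun l _ => ?_
  rw [mul_apply (M := Uᴴ), mul_apply (M := Vᴴ), Finset.sum_mul_sum, Fintype.sum_prod_type,
    Finset.mul_sum]
  refine Finset.sum_congr rfl fun a _ => ?_
  rw [Finset.mul_sum]
  refine Finset.sum_congr rfl fun b _ => ?_
  simp only [star_mul', RCLike.star_def, Complex.conj_ofReal, conjTranspose_apply]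
  ring

lemma correlation_eq_pairing {ι : Type} {m n : Type*} [Fintype ι] [Fintype m] [Fintype n]
    {ψ : m × n → ℂ} {U : Matrix m ι ℂ} {V : Matrix n ι ℂ} {s : ι → ℝ}
    (hψ : ∀ p, ψ p = ∑ k, s k * (U p.1 k * V p.2 k)) (P : Matrix m m ℂ) {Q : Matrix n n ℂ}
    (hQ : Q.IsHermitian) :
    (star ψ ⬝ᵥ ((P ⊗ₖ Q) *ᵥ ψ)).re = pairing s (Uᴴ * P * U) (Vᴴ * Q * V)ᵀ := by
  rw [correlation_eq_sum hψ, pairing]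
  simp only [Complex.re_sum]
  refine Finset.sum_congr rfl fun k _ => Finset.sum_congr rfl fun l _ => ?_
  have h : star ((Vᴴ * Q * V)ᵀ k l) = (Vᴴ * Q * V) k l := by
    rw [transpose_apply, ← conjTranspose_apply, (isHermitian_conjTranspose_mul_mul V hQ).eq]
  rw [h, ← Complex.ofReal_mul, Complex.re_ofReal_mul]

section Rounding

variable {ι I X Sig J : Type*} [Fintype ι] [DecidableEq ι] [Fintype Sig] [DecidableEq Sig]
  [Nonempty Sig] [Fintype J] {Φ : I → Type*} [∀ i, Fintype (Φ i)] [∀ i, Nonempty (Φ i)]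

/-- POVMs that are nearly consistent in a bipartite state can be replaced by projective
measurements that are nearly consistent in the tracial state of a matrix algebra. -/
lemma exists_projective_consistent {A : ∀ i, Φ i → Matrix ι ι ℂ} {B : X → Sig → Matrix ι ι ℂ}
    (hA : ∀ i, IsPOVM (A i)) (hB : ∀ x, IsPOVM (B x)) (a : J → I) (b : J → X)
    (g : ∀ j, Φ (a j) → Sig) {s : ι → ℝ} (hs : ∀ k, 0 < s k) (hs1 : ∑ k, s k ^ 2 = 1)
    {w : J → ℝ} (hw : ∀ j, 0 ≤ w j) (hw1 : ∑ j, w j = 1) {Δ δ : J → ℝ} {T : ℝ} (hT : 0 ≤ T)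
    (hΔ : ∀ j, 1 - 2 * Δ j ≤ ∑ φ, pairing s (A (a j) φ) (A (a j) φ))
    (hδ : ∀ j, 1 - δ j ≤ ∑ φ, pairing s (A (a j) φ) (B (b j) (g j φ)))
    (hΔT : ∑ j, w j * Δ j ≤ T) (hδT : ∑ j, w j * δ j ≤ T) :
    ∃ (n : ℕ) (R : ∀ i, Φ i → Matrix (Fin n) (Fin n) ℂ) (S : X → Sig → Matrix (Fin n) (Fin n) ℂ),
      1 ≤ n ∧ (∀ i, IsPOVM (R i)) ∧ (∀ i φ, R i φ * R i φ = R i φ) ∧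
      (∀ x, IsPOVM (S x)) ∧ (∀ x σ, S x σ * S x σ = S x σ) ∧
      1 - (27 * T + 30 * √T) ≤
        ∑ j, w j * ∑ φ, (n : ℝ)⁻¹ * pairing (fun _ => 1) (R (a j) φ) (S (b j) (g j φ)) := by
  have hδ' : ∀ j, 1 - δ j ≤ ∑ σ, pairing s (marginal (A (a j)) (g j) σ) (B (b j) σ) := by
    intro j
    rw [sum_pairing_marginal]
    exact hδ j
  obtain ⟨n, e, hn, he, hle⟩ := exists_corner (A := fun j => A (a j)) (B := fun j => B (b j)) g
    (fun j => hA _) (fun j => hB _) hs hs1 hw hw1 hT hΔ hδ' hΔT hδT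
  have hA' := fun i => (hA i).submatrix he
  have hB' := fun x => (hB x).submatrix he
  choose R hR hRR hRA using fun i => (hA' i).exists_projective
  choose S hS hSS hSB using fun x => (hB' x).exists_projective
  refine ⟨n, R, S, hn, hR, hRR, hS, hSS, ?_⟩
  have hn0 : (0 : ℝ) < n := by exact_mod_cast hn
  have h1 : ∑ j, w j * (n - ∑ φ, pairing (fun _ => 1) (R (a j) φ) (S (b j) (g j φ))) ≤
      n * (27 * T + 30 * √T) := by
    refine le_trans (Finset.sum_le_sum fun j _ => mul_le_mul_of_nonneg_left ?_ (hw j)) hle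
    have h2 := card_sub_sum_pairing_le (g j) (hA' (a j)) (hB' (b j)) (hR _) (hRR _) (hS _) (hSS _)
      (by simpa using hRA (a j)) (by simpa using hSB (b j))
    have h3 : ∀ σ, marginal (fun φ => (A (a j) φ).submatrix e e) (g j) σ =
        (marginal (A (a j)) (g j) σ).submatrix e e := by
      intro σ
      ext k l
      simp only [marginal, Matrix.sum_apply, submatrix_apply]
      refine Finset.sum_congr rfl fun φ _ => ?_
      split_ifs <;> rfl
    simp only [Fintype.card_fin, h3] at h2
    exact h2
  simp only [mul_sub, Finset.sum_sub_distrib, ← Finset.sum_mul, hw1, one_mul] at h1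
  have h4 : ∑ j, w j * ∑ φ, (n : ℝ)⁻¹ * pairing (fun _ => 1) (R (a j) φ) (S (b j) (g j φ)) =
      (n : ℝ)⁻¹ * ∑ j, w j * ∑ φ, pairing (fun _ => 1) (R (a j) φ) (S (b j) (g j φ)) := by
    simp only [Finset.mul_sum]
    refine Finset.sum_congr rfl fun j _ => Finset.sum_congr rfl fun φ _ => ?_
    ring
  rw [h4, ← mul_le_mul_iff_right₀ hn0, ← mul_assoc, mul_inv_cancel₀ hn0.ne']
  linarith

end Rounding

lemma one_sub_rpow_le {T x : ℝ} (hT : 0 ≤ T) (hx : 0 ≤ x) (h : 1 - (27 * T + 30 * √T) ≤ x) :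
    1 - 148 * T ^ ((1 : ℝ) / 4) ≤ x := by
  rcases le_total 1 T with h1 | h1
  · have := Real.one_le_rpow h1 (by norm_num : (0 : ℝ) ≤ 1 / 4)
    linarith
  · have h2 := Real.rpow_le_rpow_of_exponent_ge' hT h1 (by norm_num)
      (by norm_num : (1 : ℝ) / 4 ≤ 1)
    have h3 := Real.rpow_le_rpow_of_exponent_ge' hT h1 (by norm_num)
      (by norm_num : (1 : ℝ) / 4 ≤ 1 / 2)
    rw [Real.rpow_one] at h2
    rw [← Real.sqrt_eq_rpow] at h3
    have := Real.rpow_nonneg hT (1 / 4)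
    linarith

lemma pairing_self_nonneg {ι : Type*} [Fintype ι] {s : ι → ℝ} (hs : ∀ k, 0 ≤ s k)
    (M : Matrix ι ι ℂ) : 0 ≤ pairing s M M := by
  rw [pairing_self]
  exact Finset.sum_nonneg fun k _ => Finset.sum_nonneg fun l _ =>
    mul_nonneg (mul_nonneg (hs k) (hs l)) (sq_nonneg _)

lemma ofReal_pairing_one {ι : Type*} [Fintype ι] {M N : Matrix ι ι ℂ} (hM : M.IsHermitian)
    (hN : N.IsHermitian) : (pairing (fun _ => 1) M N : ℂ) = (M * N).trace := by
  rw [pairing_one_eq_trace, hN.eq]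
  refine Complex.conj_eq_iff_re.1 ?_
  rw [← RCLike.star_def, ← trace_conjTranspose, conjTranspose_mul, hM.eq, hN.eq, trace_mul_comm]
end CSGame

/-- Let `S = (X, {(Vᵢ, Cᵢ)})` be a constraint system over a finite
alphabet `Σ`, `π` a strictly positive distribution on `[m]`, and `G(S,π)` the
constraint-variable CS game.  If `c` is a quantum correlation with `w(c) ≥ 1 - ε`, then
there is a finite-dimensional tracial correlation `c'` with
`w(c') ≥ 1 - 148 (L ε)^{1/4}`, where `L = maxᵢ |Vᵢ|`. -/
theorem cs_game_almost_perfect_quantum_near_tracial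
    {X : Type} [Fintype X] [Nonempty X]
    {Sig : Type} [Fintype Sig] [Nonempty Sig]
    {m : ℕ} (hm : 0 < m)
    (Vs : Fin m → Finset X) (hVs : ∀ i, (Vs i).Nonempty)
    (C : ∀ i : Fin m, Finset ({x // x ∈ Vs i} → Sig)) (hC : ∀ i, (C i).Nonempty)
    (π : Fin m → ℝ) (hπ : ∀ i, 0 < π i) (hπ1 : ∑ i, π i = 1)
    -- `c` is a quantum correlation for `G(S,π)`
    {dA dB : ℕ}
    (P : ∀ i : Fin m, {f // f ∈ C i} → Matrix (Fin dA) (Fin dA) ℂ)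
    (Q : X → Sig → Matrix (Fin dB) (Fin dB) ℂ)
    (hP : ∀ i φ, (P i φ).PosSemidef) (hPsum : ∀ i, ∑ φ, P i φ = 1)
    (hQ : ∀ x σ, (Q x σ).PosSemidef) (hQsum : ∀ x, ∑ σ, Q x σ = 1)
    (ψ : Fin dA × Fin dB → ℂ) (hψ : star ψ ⬝ᵥ ψ = 1)
    (c : ∀ (i : Fin m) (x : X), {f // f ∈ C i} → Sig → ℝ)
    (hc : ∀ i x φ σ, (c i x φ σ : ℂ) = star ψ ⬝ᵥ ((P i φ ⊗ₖ Q x σ) *ᵥ ψ))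
    -- the strategy wins with probability at least `1 - ε`
    (ε : ℝ)
    (hw : 1 - ε ≤ ∑ i, ∑ x ∈ (Vs i).attach,
      (π i / (Vs i).card) * ∑ φ : {f // f ∈ C i}, c i x.1 φ (φ.1 x)) :
    ∃ (n : ℕ) (r : ∀ i : Fin m, {f // f ∈ C i} → Matrix (Fin n) (Fin n) ℂ)
      (s : X → Sig → Matrix (Fin n) (Fin n) ℂ) (σ₀ : Matrix (Fin n) (Fin n) ℂ)
      (c' : ∀ (i : Fin m) (x : X), {f // f ∈ C i} → Sig → ℝ),
      1 ≤ n ∧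
      (∀ i φ, (r i φ).IsHermitian ∧ r i φ * r i φ = r i φ) ∧ (∀ i, ∑ φ, r i φ = 1) ∧
      (∀ x σ, (s x σ).IsHermitian ∧ s x σ * s x σ = s x σ) ∧ (∀ x, ∑ σ, s x σ = 1) ∧
      σ₀.PosSemidef ∧ σ₀.trace = 1 ∧
      (∀ u v : Matrix (Fin n) (Fin n) ℂ,
        u ∈ StarAlgebra.adjoin ℂ ({M | ∃ i φ, M = r i φ} ∪ {M | ∃ x σ, M = s x σ}) →
        v ∈ StarAlgebra.adjoin ℂ ({M | ∃ i φ, M = r i φ} ∪ {M | ∃ x σ, M = s x σ}) →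
        (σ₀ * (u * v)).trace = (σ₀ * (v * u)).trace) ∧
      (∀ i x φ σ, (c' i x φ σ : ℂ) = (σ₀ * (r i φ * s x σ)).trace) ∧
      1 - 148 * ((Finset.univ.sup fun i => (Vs i).card : ℕ) * ε) ^ ((1 : ℝ)/4)
        ≤ ∑ i, ∑ x ∈ (Vs i).attach,
            (π i / (Vs i).card) * ∑ φ : {f // f ∈ C i}, c' i x.1 φ (φ.1 x) := by
  classical
  obtain ⟨ι, _, _, U, V, s, hU, hV, hs, hψs⟩ := CSGame.exists_schmidt ψ
  let A : ∀ i, {f // f ∈ C i} → Matrix ι ι ℂ := fun i φ => Uᴴ * P i φ * U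
  let B : X → Sig → Matrix ι ι ℂ := fun x σ => (Vᴴ * Q x σ * V)ᵀ
  have hA : ∀ i, CSGame.IsPOVM (A i) := fun i =>
    (CSGame.IsPOVM.mk (hP i) (hPsum i)).compression hU
  have hB : ∀ x, CSGame.IsPOVM (B x) := fun x =>
    ((CSGame.IsPOVM.mk (hQ x) (hQsum x)).compression hV).transpose
  have hcp : ∀ i x φ σ, c i x φ σ = CSGame.pairing s (A i φ) (B x σ) := by
    intro i x φ σ
    rw [← CSGame.correlation_eq_pairing hψs (P i φ) (hQ x σ).1, ← hc, Complex.ofReal_re]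
  have hs1 : ∑ k, s k ^ 2 = 1 := by
    have h := CSGame.correlation_eq_pairing hψs 1 (Matrix.isHermitian_one (n := Fin dB) (α := ℂ))
    rw [Matrix.one_kronecker_one, Matrix.one_mulVec, hψ, Matrix.mul_one, Matrix.mul_one, hU, hV,
      Matrix.transpose_one, CSGame.pairing_one_one] at h
    simpa using h.symm
  let J := Σ i : Fin m, {x // x ∈ Vs i}
  let w : J → ℝ := fun j => π j.1 / (Vs j.1).card
  let g : ∀ j : J, {f // f ∈ C j.1} → Sig := fun j φ => φ.1 j.2
  let d : J → ℝ := fun j =>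
    1 - ∑ φ, CSGame.pairing s (A j.1 φ) (B j.2 (g j φ))
  let D : J → ℝ := fun j => ∑ x : {x // x ∈ Vs j.1}, d ⟨j.1, x⟩
  have hcard : ∀ i, (0 : ℝ) < (Vs i).card := fun i => by exact_mod_cast (hVs i).card_pos
  have hw0 : ∀ j, 0 ≤ w j := fun j => div_nonneg (hπ _).le (hcard _).le
  have hsum : ∀ i, ∑ x : {x // x ∈ Vs i}, π i / ((Vs i).card : ℝ) = π i := by
    intro i
    rw [Finset.sum_const, Finset.card_univ, Fintype.card_coe, nsmul_eq_mul,
      mul_div_cancel₀ _ (hcard i).ne']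
  have hw1 : ∑ j, w j = 1 := by
    rw [Fintype.sum_sigma, ← hπ1]
    exact Finset.sum_congr rfl fun i _ => hsum i
  have hdm : ∀ j : J, 1 - d j =
      ∑ σ, CSGame.pairing s (CSGame.marginal (A j.1) (g j) σ) (B j.2 σ) := by
    intro j
    rw [CSGame.sum_pairing_marginal]
    simp [d]
  have hd0 : ∀ j, 0 ≤ d j := by
    intro j
    have h1 := ((hA j.1).marginal (g j)).sum_pairing_sub_le (hB j.2) s
    have h2 : 0 ≤ ∑ σ, CSGame.pairing s (CSGame.marginal (A j.1) (g j) σ - B j.2 σ)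
        (CSGame.marginal (A j.1) (g j) σ - B j.2 σ) :=
      Finset.sum_nonneg fun σ _ => CSGame.pairing_self_nonneg (fun k => (hs k).le) _
    rw [hs1, ← hdm] at h1
    linarith
  have hdε : ∑ j, w j * d j ≤ ε := by
    have h : ∑ j, w j * d j = ∑ j, w j - ∑ i, ∑ x ∈ (Vs i).attach,
        (π i / (Vs i).card) * ∑ φ : {f // f ∈ C i}, c i x.1 φ (φ.1 x) := by
      simp only [← Finset.univ_eq_attach, hcp]
      rw [← Fintype.sum_sigma', ← Finset.sum_sub_distrib]
      refine Finset.sum_congr rfl fun j _ => ?_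
      simp only [w, d, g, mul_sub, mul_one]
    rw [h, hw1]
    linarith
  set L : ℕ := Finset.univ.sup fun i => (Vs i).card
  have hLc : ∀ i, (Vs i).card ≤ L := fun i =>
    Finset.le_sup (f := fun i => (Vs i).card) (Finset.mem_univ i)
  have hL1 : (1 : ℝ) ≤ L := by
    exact_mod_cast (hVs ⟨0, hm⟩).card_pos.trans_le (hLc ⟨0, hm⟩)
  have hwd0 : ∀ j, 0 ≤ w j * d j := fun j => mul_nonneg (hw0 j) (hd0 j)
  have hε : 0 ≤ ε := (Finset.sum_nonneg fun j _ => hwd0 j).trans hdε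
  have hT : 0 ≤ L * ε := by positivity
  have hdT : ∑ j, w j * d j ≤ L * ε := hdε.trans (by nlinarith)
  have hDT : ∑ j, w j * D j ≤ L * ε := by
    refine le_trans ?_ (mul_le_mul_of_nonneg_left hdε (by positivity : (0 : ℝ) ≤ L))
    rw [Fintype.sum_sigma, Fintype.sum_sigma, Finset.mul_sum]
    refine Finset.sum_le_sum fun i _ => ?_
    have h : ∀ x : {x // x ∈ Vs i}, w ⟨i, x⟩ * D ⟨i, x⟩ =
        π i / (Vs i).card * ∑ y : {x // x ∈ Vs i}, d ⟨i, y⟩ := fun _ => rfl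
    have h' : ∑ y : {x // x ∈ Vs i}, w ⟨i, y⟩ * d ⟨i, y⟩ =
        π i / (Vs i).card * ∑ y : {x // x ∈ Vs i}, d ⟨i, y⟩ := by rw [Finset.mul_sum]
    rw [Finset.sum_congr rfl fun x _ => h x, h', Finset.sum_const, Finset.card_univ,
      Fintype.card_coe, nsmul_eq_mul]
    exact mul_le_mul_of_nonneg_right (by exact_mod_cast hLc i)
      (h' ▸ Finset.sum_nonneg fun x _ => hwd0 _)
  have hD : ∀ j, 1 - 2 * D j ≤ ∑ φ, CSGame.pairing s (A j.1 φ) (A j.1 φ) := by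
    rintro ⟨i, x₀⟩
    have h1 := (hA i).union_bound s (fun (x : {x // x ∈ Vs i}) φ => φ.1 x)
      fun φ φ' h => Subtype.ext (funext h)
    rw [hs1] at h1
    have h2 : ∑ x : {x // x ∈ Vs i}, (1 - ∑ σ, CSGame.pairing s
        (CSGame.marginal (A i) (fun φ => φ.1 x) σ) (CSGame.marginal (A i) (fun φ => φ.1 x) σ)) ≤
        ∑ x : {x // x ∈ Vs i}, 2 * d ⟨i, x⟩ := by
      refine Finset.sum_le_sum fun x _ => ?_
      have h3 := hdm ⟨i, x⟩
      have h4 := (hB x).sum_pairing_self_le s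
      have h5 : 0 ≤ ∑ σ, CSGame.pairing s
          (CSGame.marginal (A i) (fun φ => φ.1 x) σ - B x σ)
          (CSGame.marginal (A i) (fun φ => φ.1 x) σ - B x σ) :=
        Finset.sum_nonneg fun σ _ => CSGame.pairing_self_nonneg (fun k => (hs k).le) _
      simp only [CSGame.pairing_sub_self, Finset.sum_sub_distrib, Finset.sum_add_distrib,
        ← Finset.mul_sum] at h5
      rw [hs1] at h4
      simp only [g] at h3
      linarith
    rw [← Finset.mul_sum] at h2
    simp only [D]
    linarith
  have : ∀ i, Nonempty {f // f ∈ C i} := fun i => (hC i).to_subtype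
  obtain ⟨n, R, S, hn, hR, hRR, hS, hSS, hle⟩ := CSGame.exists_projective_consistent hA hB
    (fun j : J => j.1) (fun j : J => (j.2 : X)) g hs hs1 hw0 hw1 hT hD
    (fun j => by simp [d]) hDT hdT
  have hn0 : (0 : ℝ) < n := by exact_mod_cast hn
  have htr : ∀ M : Matrix (Fin n) (Fin n) ℂ,
      ((((n : ℝ)⁻¹ : ℝ) : ℂ) • (1 : Matrix (Fin n) (Fin n) ℂ) * M).trace =
        (((n : ℝ)⁻¹ : ℝ) : ℂ) * M.trace := by
    intro M
    rw [Matrix.smul_mul, Matrix.one_mul, Matrix.trace_smul, smul_eq_mul]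
  refine ⟨n, R, S, (((n : ℝ)⁻¹ : ℝ) : ℂ) • 1,
    fun i x φ σ => (n : ℝ)⁻¹ * CSGame.pairing (fun _ => 1) (R i φ) (S x σ), hn,
    fun i φ => ⟨((hR i).posSemidef φ).1, hRR i φ⟩, fun i => (hR i).sum_eq_one,
    fun x σ => ⟨((hS x).posSemidef σ).1, hSS x σ⟩, fun x => (hS x).sum_eq_one,
    Matrix.PosSemidef.one.smul (by exact_mod_cast inv_nonneg.2 hn0.le), ?_, ?_, ?_, ?_⟩
  · rw [← Matrix.mul_one ((((n : ℝ)⁻¹ : ℝ) : ℂ) • (1 : Matrix (Fin n) (Fin n) ℂ)), htr,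
      Matrix.trace_one, Fintype.card_fin]
    push_cast
    exact inv_mul_cancel₀ (by exact_mod_cast hn0.ne')
  · intro u v _ _
    rw [htr, htr, Matrix.trace_mul_comm]
  · intro i x φ σ
    rw [htr, ← CSGame.ofReal_pairing_one ((hR i).posSemidef φ).1 ((hS x).posSemidef σ).1,
      Complex.ofReal_mul]
  · have hwin : ∑ j : J, w j * ∑ φ, (n : ℝ)⁻¹ *
        CSGame.pairing (fun _ => 1) (R j.1 φ) (S j.2 (g j φ)) =
        ∑ i, ∑ x ∈ (Vs i).attach, (π i / (Vs i).card) * ∑ φ : {f // f ∈ C i},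
          (n : ℝ)⁻¹ * CSGame.pairing (fun _ => 1) (R i φ) (S x (φ.1 x)) := by
      simp only [← Finset.univ_eq_attach]
      exact Fintype.sum_sigma _
    rw [← hwin]
    refine CSGame.one_sub_rpow_le hT (Finset.sum_nonneg fun j _ => mul_nonneg (hw0 j)
      (Finset.sum_nonneg fun φ _ => mul_nonneg (inv_nonneg.2 hn0.le) ?_)) hle
    exact CSGame.pairing_nonneg _ ((hR _).posSemidef _) ((hS _).posSemidef _)
end

section
/- Let c be a finite-dimensional tracial correlation: suppose there exist n ≥ 1, PVMs {A^i_a}_{a∈A_i} and {B^j_b}_{b∈B_j} of orthogonal projections in M_n(ℂ), and a positive semidefinite σ ∈ M_n(ℂ) with Tr(σ) = 1 such that Tr(σ x y) = Tr(σ y x) for all x, y in the unital *-subalgebra of M_n(ℂ) generated by all the A^i_a and B^j_b, and c(a,b|i,j) = Tr(σ A^i_a B^j_b) for all i, j, a, b. Then c is a quantum correlation: there exist finite-dimensional Hilbert spaces H_A, H_B, POVMs {P^i_a}_{a∈A_i} on H_A and {Q^j_b}_{b∈B_j} on H_B, and a unit vector ψ ∈ H_A ⊗ H_B such that c(a,b|i,j)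 = ⟨ψ, (P^i_a ⊗ Q^j_b) ψ⟩ for all i, j, a, b. -/
open scoped ComplexOrder Kronecker Matrix

namespace Matrix

variable {m : Type*} [Fintype m]

open scoped MatrixOrder Matrix.Norms.L2Operator in
theorem PosSemidef.trace_mul_nonneg {M N : Matrix m m ℂ} (hM : M.PosSemidef)
    (hN : N.PosSemidef) : 0 ≤ (M * N).trace := by
  classical
  obtain ⟨X, rfl⟩ := CStarAlgebra.nonneg_iff_eq_star_mul_self.mp (nonneg_iff_posSemidef.mpr hM)
  rw [star_eq_conjTranspose, mul_assoc, trace_mul_comm]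
  exact (hN.mul_mul_conjTranspose_same X).trace_nonneg

theorem IsHermitian.posSemidef_of_mul_self {M : Matrix m m ℂ} (hM : M.IsHermitian)
    (h : M * M = M) : M.PosSemidef := by
  have := posSemidef_conjTranspose_mul_self M
  rwa [hM.eq, h] at this

variable [DecidableEq m]

/-- Real functional calculus of a matrix stays in every complex *-subalgebra containing it. -/
theorem cfc_mem_starSubalgebra (S : StarSubalgebra ℂ (Matrix m m ℂ)) {M : Matrix m m ℂ}
    (hM : M ∈ S) (f : ℝ → ℝ) : cfc f M ∈ S := by
  let T : StarSubalgebra ℝ (Matrix m m ℂ) :=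
    { S.toSubalgebra.restrictScalars ℝ with star_mem' := star_mem (s := S) }
  have hclosed : IsClosed (T : Set (Matrix m m ℂ)) :=
    Submodule.closed_of_finiteDimensional (Subalgebra.toSubmodule S.toSubalgebra)
  exact StarAlgebra.elemental.le_of_mem (S := T) hclosed hM (cfc_mem_elemental f M)

/-- The trace pairing restricted to a *-subalgebra is nondegenerate, so every trace functional
is represented by an element of the subalgebra. -/
theorem exists_mem_trace_mul_eq (S : StarSubalgebra ℂ (Matrix m m ℂ)) (σ : Matrix m m ℂ) :
    ∃ D ∈ S, ∀ x ∈ S, (D * x).trace = (σ * x).trace := by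
  let V := Subalgebra.toSubmodule S.toSubalgebra
  let φ : Matrix m m ℂ →ₗ[ℂ] Module.Dual ℂ V :=
    ((LinearMap.mul ℂ (Matrix m m ℂ)).compr₂ (traceLinearMap m ℂ ℂ)).compl₂ V.subtype
  have hφ (d : Matrix m m ℂ) (x : V) : φ d x = (d * x).trace := rfl
  have hinj : Function.Injective (φ ∘ₗ V.subtype) := by
    rw [← LinearMap.ker_eq_bot, LinearMap.ker_eq_bot']
    intro d hd
    have h : ((d : Matrix m m ℂ) * (d : Matrix m m ℂ)ᴴ).trace = 0 :=
      LinearMap.congr_fun hd ⟨star (d : Matrix m m ℂ), star_mem (s := S) d.2⟩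
    exact Subtype.ext (trace_mul_conjTranspose_self_eq_zero_iff.mp h)
  have hsurj := (LinearMap.injective_iff_surjective_of_finrank_eq_finrank
    (Subspace.dual_finrank_eq (K := ℂ) (V := V)).symm).mp hinj
  obtain ⟨D, hD⟩ := hsurj (φ σ)
  exact ⟨D, D.2, fun x hx => LinearMap.congr_fun hD ⟨x, hx⟩⟩

theorem eq_of_trace_mul_eq {S : StarSubalgebra ℂ (Matrix m m ℂ)} {M N : Matrix m m ℂ}
    (hM : M ∈ S) (hN : N ∈ S) (h : ∀ x ∈ S, (M * x).trace = (N * x).trace) : M = N := by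
  have h0 := h _ (star_mem (sub_mem hM hN))
  rw [← sub_eq_zero, ← trace_sub, ← sub_mul] at h0
  exact sub_eq_zero.mp (trace_mul_conjTranspose_self_eq_zero_iff.mp h0)

open scoped MatrixOrder in
/-- A Hermitian element of a *-subalgebra is positive semidefinite once it pairs nonnegatively
with the positive semidefinite elements of that subalgebra. -/
theorem IsHermitian.posSemidef_of_trace_mul_nonneg {S : StarSubalgebra ℂ (Matrix m m ℂ)}
    {D : Matrix m m ℂ} (hD : D.IsHermitian) (hDS : D ∈ S)
    (h : ∀ x ∈ S, x.PosSemidef → 0 ≤ (D * x).trace) : D.PosSemidef := by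
  have hD' : IsSelfAdjoint D := hD
  have hN : (D⁻).PosSemidef := nonneg_iff_posSemidef.mp (CFC.negPart_nonneg D)
  have hNS : D⁻ ∈ S := by
    rw [CFC.negPart_def, cfcₙ_eq_cfc]
    exact cfc_mem_starSubalgebra S hDS _
  have hmul : D * D⁻ = -(D⁻ᴴ * D⁻) := by
    calc D * D⁻ = (D⁺ - D⁻) * D⁻ := by rw [CFC.posPart_sub_negPart D hD']
      _ = -(D⁻ᴴ * D⁻) := by
        rw [sub_mul, CFC.posPart_mul_negPart, zero_sub, hN.isHermitian.eq]
  have h1 := h _ hNS hN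
  rw [hmul, trace_neg, neg_nonneg] at h1
  have h2 := le_antisymm h1 (posSemidef_conjTranspose_mul_self D⁻).trace_nonneg
  rw [trace_conjTranspose_mul_self_eq_zero_iff] at h2
  exact nonneg_iff_posSemidef.mp ((CFC.negPart_eq_zero_iff D hD').mp h2)

/-- A density matrix that is tracial on a *-subalgebra may be replaced by a positive semidefinite
matrix commuting with that subalgebra. -/
theorem exists_posSemidef_commute_trace_mul_eq (S : StarSubalgebra ℂ (Matrix m m ℂ))
    {σ : Matrix m m ℂ} (hσ : σ.PosSemidef)
    (htrace : ∀ x ∈ S, ∀ y ∈ S, (σ * (x * y)).trace = (σ * (y * x)).trace) :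
    ∃ D : Matrix m m ℂ, D.PosSemidef ∧ (∀ x ∈ S, Commute D x) ∧
      ∀ x ∈ S, (D * x).trace = (σ * x).trace := by
  obtain ⟨D, hDS, hD⟩ := exists_mem_trace_mul_eq S σ
  have hherm : D.IsHermitian := by
    refine eq_of_trace_mul_eq (S := S) (star_mem hDS) hDS fun x hx => ?_
    have hconj : (Dᴴ * x).trace = star (D * xᴴ).trace := by
      rw [← trace_conjTranspose, conjTranspose_mul, conjTranspose_conjTranspose, trace_mul_comm]
    rw [hconj, ← star_eq_conjTranspose, hD _ (star_mem hx), hD _ hx, ← trace_conjTranspose,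
      star_eq_conjTranspose, conjTranspose_mul, conjTranspose_conjTranspose, hσ.isHermitian.eq,
      trace_mul_comm]
  refine ⟨D, hherm.posSemidef_of_trace_mul_nonneg hDS fun x hx hpos => ?_, fun x hx => ?_, hD⟩
  · rw [hD x hx]
    exact hσ.trace_mul_nonneg hpos
  · refine eq_of_trace_mul_eq (mul_mem hDS hx) (mul_mem hx hDS) fun y hy => ?_
    rw [mul_assoc, hD _ (mul_mem hx hy), htrace x hx y hy, ← hD _ (mul_mem hy hx),
      ← mul_assoc, trace_mul_comm, mul_assoc]

open scoped MatrixOrder in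
theorem PosSemidef.exists_isHermitian_sqrt {D : Matrix m m ℂ} (hD : D.PosSemidef) :
    ∃ E : Matrix m m ℂ, E.IsHermitian ∧ E * E = D ∧ ∀ x, Commute D x → Commute E x := by
  have h0 : 0 ≤ D := nonneg_iff_posSemidef.mpr hD
  refine ⟨CFC.sqrt D, (nonneg_iff_posSemidef.mp (CFC.sqrt_nonneg D)).isHermitian,
    CFC.sqrt_mul_sqrt_self D h0, fun x hx => ?_⟩
  rw [CFC.sqrt_eq_cfc]
  exact hx.cfc_nnreal _

end Matrix

/-- Every finite-dimensional tracial correlation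
`c(a,b|i,j) = Tr(σ A^i_a B^j_b)` (PVMs of projections in `Mₙ(ℂ)`, `σ` a density matrix
tracial on the generated unital *-subalgebra) is a quantum correlation: it is realized
by POVMs on finite-dimensional Hilbert spaces and a unit vector in their tensor
product. -/
theorem finite_dimensional_tracial_correlation_is_quantum
    {I J : Type} [Fintype I] [Fintype J] [Nonempty I] [Nonempty J]
    {A : I → Type} [∀ i, Fintype (A i)] [∀ i, Nonempty (A i)]
    {B : J → Type} [∀ j, Fintype (B j)] [∀ j, Nonempty (B j)]
    (c : ∀ i j, A i → B j → ℝ)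
    {n : ℕ} (hn : 1 ≤ n)
    (r : ∀ i, A i → Matrix (Fin n) (Fin n) ℂ)
    (s : ∀ j, B j → Matrix (Fin n) (Fin n) ℂ)
    (hr : ∀ i a, (r i a).IsHermitian ∧ r i a * r i a = r i a)
    (hrsum : ∀ i, ∑ a, r i a = 1)
    (hs : ∀ j b, (s j b).IsHermitian ∧ s j b * s j b = s j b)
    (hssum : ∀ j, ∑ b, s j b = 1)
    (σ : Matrix (Fin n) (Fin n) ℂ)
    (hσ : σ.PosSemidef) (hσtr : σ.trace = 1)
    (htrace : ∀ x y : Matrix (Fin n) (Fin n) ℂ,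
      x ∈ StarAlgebra.adjoin ℂ
        ({M | ∃ i a, M = r i a} ∪ {M | ∃ j b, M = s j b}) →
      y ∈ StarAlgebra.adjoin ℂ
        ({M | ∃ i a, M = r i a} ∪ {M | ∃ j b, M = s j b}) →
      (σ * (x * y)).trace = (σ * (y * x)).trace)
    (hc : ∀ i j a b, (c i j a b : ℂ) = (σ * (r i a * s j b)).trace) :
    ∃ (dA dB : ℕ)
      (P : ∀ i, A i → Matrix (Fin dA) (Fin dA) ℂ)
      (Q : ∀ j, B j → Matrix (Fin dB) (Fin dB) ℂ)
      (ψ : Fin dA × Fin dB → ℂ),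
      (∀ i a, (P i a).PosSemidef) ∧ (∀ i, ∑ a, P i a = 1) ∧
      (∀ j b, (Q j b).PosSemidef) ∧ (∀ j, ∑ b, Q j b = 1) ∧
      star ψ ⬝ᵥ ψ = 1 ∧
      (∀ i j a b, (c i j a b : ℂ) = star ψ ⬝ᵥ ((P i a ⊗ₖ Q j b) *ᵥ ψ)) := by
  set S := StarAlgebra.adjoin ℂ ({M | ∃ i a, M = r i a} ∪ {M | ∃ j b, M = s j b})
  have hrS (i a) : r i a ∈ S := StarAlgebra.subset_adjoin ℂ _ (Or.inl ⟨i, a, rfl⟩)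
  have hsS (j b) : s j b ∈ S := StarAlgebra.subset_adjoin ℂ _ (Or.inr ⟨j, b, rfl⟩)
  obtain ⟨D, hDpos, hDcomm, hD⟩ := Matrix.exists_posSemidef_commute_trace_mul_eq S hσ
    fun x hx y hy => htrace x y hx hy
  obtain ⟨E, hE, hEE, hEcomm⟩ := hDpos.exists_isHermitian_sqrt
  refine ⟨n, n, fun i a => (r i a)ᵀ, s, E.vec,
    fun i a => ((hr i a).1.posSemidef_of_mul_self (hr i a).2).transpose,
    fun i => by rw [← Matrix.transpose_sum, hrsum, Matrix.transpose_one],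
    fun j b => (hs j b).1.posSemidef_of_mul_self (hs j b).2, hssum, ?_, fun i j a b => ?_⟩
  · rw [Matrix.star_vec_dotProduct_vec, hE.eq, hEE, ← hσtr]
    simpa using hD 1 (one_mem S)
  · rw [Matrix.kronecker_mulVec_vec, Matrix.star_vec_dotProduct_vec, hE.eq,
      Matrix.transpose_transpose, hc, ← hD _ (mul_mem (hrS i a) (hsS j b)), ← hEE]
    calc (E * E * (r i a * s j b)).trace = (E * (E * r i a) * s j b).trace := by
          simp only [mul_assoc]
      _ = (E * r i a * (E * s j b)).trace := by
          conv_lhs => rw [(hEcomm _ (hDcomm _ (hrS i a))).eq]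
          simp only [mul_assoc]
      _ = (E * (s j b * E * r i a)).trace := by
          rw [Matrix.trace_mul_comm]
          simp only [mul_assoc]
end
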